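/- arXiv:1509.05752 — 4 statements merged into one kernel-verified Lean document; each statement's English description precedes it below -/
import Mathlib

section
/- For all integers r ≥ 1 and m ≥ 1, Σ_{(j_1,…,j_r) ∈ J_{r,m}} ∏_{k=1}^r j_k = (m+1)_{2r} / (2^r · r!), where J_{r,m} = { (j_1,…,j_r) : 1 ≤ j_1 < ⋯ < j_r ≤ m and j_{k+1} ≥ j_k + 2 for all k = 1, …, r−1 }. -/
open scoped BigOperators

/-- The tuples in `{1, …, m}` of length `r` whose entries increase by at least `2`. -/
def gappedTuples (r m : ℕ) : Set (Fin r → ℕ) :=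
  {j | (∀ k, 1 ≤ j k) ∧ (∀ k, j k ≤ m) ∧ ∀ a b, a < b → j a + 2 ≤ j b}

theorem gappedTuples_eq (r m : ℕ) :
    {j : Fin r → ℕ | StrictMono j ∧ (∀ k, 1 ≤ j k) ∧ (∀ k, j k ≤ m) ∧
      (∀ k : Fin r, ∀ h : (k : ℕ) + 1 < r, j k + 2 ≤ j ⟨(k : ℕ) + 1, h⟩)} =
      gappedTuples r m := by
  ext j
  constructor
  · rintro ⟨hmono, hpos, hle, hgap⟩
    refine ⟨hpos, hle, fun a b hab => ?_⟩
    have hsucc : (a : ℕ) + 1 < r := lt_of_le_of_lt hab b.isLt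
    exact (hgap a hsucc).trans (hmono.monotone (Fin.mk_le_of_le_val hab))
  · rintro ⟨hpos, hle, hgap⟩
    refine ⟨fun a b hab => ?_, hpos, hle, fun k h => hgap _ _ (Fin.lt_def.2 (Nat.lt_succ_self _))⟩
    have := hgap a b hab
    omega

theorem finite_gappedTuples (r m : ℕ) : (gappedTuples r m).Finite :=
  (Set.finite_Iic (fun _ : Fin r => m)).subset fun _ hj => hj.2.1

theorem gappedTuples_succ_zero (r : ℕ) : gappedTuples (r + 1) 0 = ∅ := by
  ext j
  simp only [Set.mem_empty_iff_false, iff_false]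
  rintro ⟨hpos, hle, -⟩
  have := hpos 0
  have := hle 0
  omega

theorem gappedTuples_succ_succ (r m : ℕ) :
    gappedTuples (r + 1) (m + 1) = gappedTuples (r + 1) m ∪
      (fun j : Fin r → ℕ => (Fin.snoc j (m + 1) : Fin (r + 1) → ℕ)) ''
        gappedTuples r (m - 1) := by
  ext j
  constructor
  · rintro ⟨hpos, hle, hgap⟩
    by_cases hlast : j (Fin.last r) ≤ m
    · refine Or.inl ⟨hpos, fun k => ?_, hgap⟩
      rcases (Fin.le_last k).eq_or_lt with rfl | hk
      · exact hlast
      · have := hgap _ _ hk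
        omega
    · have hlast_eq : j (Fin.last r) = m + 1 := by
        have := hle (Fin.last r)
        omega
      refine Or.inr ⟨Fin.init j, ⟨fun k => hpos _, fun k => ?_, fun a b hab => ?_⟩, ?_⟩
      · have := hgap _ _ (Fin.castSucc_lt_last k)
        simp only [Fin.init]
        omega
      · exact hgap _ _ (Fin.castSucc_lt_castSucc_iff.2 hab)
      · simp only [← hlast_eq, Fin.snoc_init_self]
  · rintro (⟨hpos, hle, hgap⟩ | ⟨i, ⟨hpos, hle, hgap⟩, rfl⟩)
    · exact ⟨hpos, fun k => (hle k).trans m.le_succ, hgap⟩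
    · refine ⟨fun k => ?_, fun k => ?_, fun a b hab => ?_⟩
      · refine Fin.lastCases ?_ (fun k => ?_) k
        · simp
        · simpa using hpos k
      · refine Fin.lastCases ?_ (fun k => ?_) k
        · simp
        · have := hle k
          simp only [Fin.snoc_castSucc]
          omega
      · induction b using Fin.lastCases with
        | last =>
          induction a using Fin.lastCases with
          | last => exact absurd hab (lt_irrefl _)
          | cast a =>
            have := hpos a
            have := hle a
            simp only [Fin.snoc_castSucc, Fin.snoc_last]
            omega
        | cast b =>
          induction a using Fin.lastCases with
          | last => exact absurd hab (Fin.le_last _).not_gt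
          | cast a =>
            simpa using hgap a b (Fin.castSucc_lt_castSucc_iff.1 hab)

theorem finsum_gappedTuples_succ_succ (r m : ℕ) :
    ∑ᶠ j ∈ gappedTuples (r + 1) (m + 1), ∏ k, (j k : ℝ) =
      ∑ᶠ j ∈ gappedTuples (r + 1) m, ∏ k, (j k : ℝ) +
        ((m : ℝ) + 1) * ∑ᶠ j ∈ gappedTuples r (m - 1), ∏ k, (j k : ℝ) := by
  rw [gappedTuples_succ_succ, finsum_mem_union _ (finite_gappedTuples _ _)
    ((finite_gappedTuples _ _).image _), finsum_mem_image,
    mul_finsum_mem' (fun j : Fin r → ℕ => ∏ k, (j k : ℝ)) _ (finite_gappedTuples r (m - 1))]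
  · simp [Fin.prod_univ_castSucc, mul_comm]
  · exact fun i _ j _ hij => (Fin.snoc_injective2 hij).1
  · refine Set.disjoint_left.2 ?_
    rintro _ ⟨-, hle, -⟩ ⟨i, -, rfl⟩
    have := hle (Fin.last r)
    simp only [Fin.snoc_last] at this
    omega

theorem prod_range_add_two_sub (x : ℝ) (n : ℕ) :
    ∏ i ∈ Finset.range (n + 2), (x + 1 + 1 - (i : ℝ)) =
      ∏ i ∈ Finset.range (n + 2), (x + 1 - (i : ℝ)) +
        ((n : ℝ) + 2) * (x + 1) * ∏ i ∈ Finset.range n, (x - (i : ℝ)) := by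
  have hshift (y : ℝ) (l : ℕ) : ∏ i ∈ Finset.range (l + 1), (y + 1 - (i : ℝ)) =
      (∏ i ∈ Finset.range l, (y - (i : ℝ))) * (y + 1) := by
    rw [Finset.prod_range_succ']
    simp
  rw [hshift (x + 1), Finset.prod_range_succ _ (n + 1), hshift x]
  push_cast
  ring

theorem finsum_gappedTuples (r m : ℕ) :
    ∑ᶠ j ∈ gappedTuples r m, ∏ k, (j k : ℝ) =
      (∏ i ∈ Finset.range (2 * r), ((m : ℝ) + 1 - (i : ℝ))) /
        (2 ^ r * (Nat.factorial r : ℝ)) := by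
  induction m using Nat.strong_induction_on generalizing r with
  | _ m ih =>
    rcases r with _ | r
    · have huniv : gappedTuples 0 m = {Fin.elim0} := by
        ext j
        simp [gappedTuples, Subsingleton.elim j Fin.elim0]
      rw [huniv, finsum_mem_singleton]
      simp
    rcases m with _ | m
    · rw [gappedTuples_succ_zero, finsum_mem_empty,
        Finset.prod_eq_zero (i := 1) (by simp; omega) (by simp), zero_div]
    have hpred : ∏ i ∈ Finset.range (2 * r), (((m - 1 : ℕ) : ℝ) + 1 - (i : ℝ)) =
        ∏ i ∈ Finset.range (2 * r), ((m : ℝ) - (i : ℝ)) := by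
      rcases m with _ | m
      · rcases r with _ | r
        · simp
        · rw [Finset.prod_eq_zero (i := 1) (by simp; omega) (by simp),
            Finset.prod_eq_zero (i := 0) (by simp) (by simp)]
      · simp
    rw [finsum_gappedTuples_succ_succ, ih m m.lt_succ_self, ih (m - 1) (by omega), hpred,
      Nat.cast_succ, show 2 * (r + 1) = 2 * r + 2 by ring, prod_range_add_two_sub,
      Nat.factorial_succ]
    have := Nat.cast_ne_zero (R := ℝ).2 r.factorial_ne_zero
    push_cast
    field_simp
    ring

/-- `Σ_{(j_1,…,j_r) ∈ J_{r,m}} ∏_k j_k = (m+1)_{2r} / (2^r r!)`, where `J_{r,m}` is the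
set of strictly increasing tuples `1 ≤ j_1 < ⋯ < j_r ≤ m` with consecutive gaps `≥ 2`. -/
theorem sum_over_gapped_tuples (r m : ℕ) (hr : 1 ≤ r) (hm : 1 ≤ m) :
    (∑ᶠ j ∈ {j : Fin r → ℕ | StrictMono j ∧ (∀ k, 1 ≤ j k) ∧ (∀ k, j k ≤ m) ∧
        (∀ k : Fin r, ∀ h : (k : ℕ) + 1 < r, j k + 2 ≤ j ⟨(k : ℕ) + 1, h⟩)},
      ∏ k : Fin r, (j k : ℝ))
      = (∏ i ∈ Finset.range (2 * r), ((m : ℝ) + 1 - (i : ℝ))) /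
        (2 ^ r * (Nat.factorial r : ℝ)) := by
  rw [gappedTuples_eq]
  exact finsum_gappedTuples r m
end

section
/- Let n ≥ 1, let α, β > 0 with a = 1/α and b = 1/β, let r ≥ 1, and let 1 ≤ j_1 < ⋯ < j_r ≤ n−1 satisfy j_{k+1} ≥ j_k + 2 for all k = 1, …, r−1. Then the probability under ℙ_{n,α,β} that, for every l = 1, …, r, the box (n−j_l, j_l) contains α equals ∏_{l=1}^r (b + j_l − 2l + 1) / ((n+a+b−2l+1)(n+a+b−2l)). -/
open scoped BigOperators

/-- A symbol in an α/β-staircase tableau: empty, α, or β. -/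
inductive StairSymb : Type
  | empty : StairSymb
  | alpha : StairSymb
  | beta  : StairSymb
  deriving DecidableEq

/-- `S` is an α/β-staircase tableau of size `n` (1-based indexing; boxes are the
pairs `(i,j)` with `1 ≤ i`, `1 ≤ j`, `i + j ≤ n + 1`; outside the boxes `S` is empty). -/
def IsStaircase (n : ℕ) (S : ℕ → ℕ → StairSymb) : Prop :=
  (∀ i j, ¬(1 ≤ i ∧ 1 ≤ j ∧ i + j ≤ n + 1) → S i j = StairSymb.empty) ∧
  (∀ i i' j, 1 ≤ i → i < i' → 1 ≤ j → i' + j ≤ n + 1 →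
    S i' j = StairSymb.alpha → S i j = StairSymb.empty) ∧
  (∀ i j j', 1 ≤ i → 1 ≤ j → j < j' → i + j' ≤ n + 1 →
    S i j' = StairSymb.beta → S i j = StairSymb.empty) ∧
  (∀ i j, 1 ≤ i → 1 ≤ j → i + j = n + 1 → S i j ≠ StairSymb.empty)

/-- The weight `wt(S) = α^{N_α(S)} β^{N_β(S)}` of a tableau. -/
noncomputable def stairWt (α β : ℝ) (S : ℕ → ℕ → StairSymb) : ℝ :=
  α ^ Set.ncard {p : ℕ × ℕ | S p.1 p.2 = StairSymb.alpha} *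
  β ^ Set.ncard {p : ℕ × ℕ | S p.1 p.2 = StairSymb.beta}

/-- The partition function `Z_n(α,β)`, the total weight of all tableaux of size `n`. -/
noncomputable def stairZ (n : ℕ) (α β : ℝ) : ℝ :=
  ∑ᶠ S ∈ {S : ℕ → ℕ → StairSymb | IsStaircase n S}, stairWt α β S

/-- The probability `ℙ_{n,α,β}(E)` of an event `E` (a set of tableaux of size `n`). -/
noncomputable def stairP (n : ℕ) (α β : ℝ) (E : (ℕ → ℕ → StairSymb) → Prop) : ℝ :=
  (∑ᶠ S ∈ {S : ℕ → ℕ → StairSymb | IsStaircase n S ∧ E S}, stairWt α β S) / stairZ n α β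

/-- The expectation `E_{n,α,β}[f]` of a real function of the random tableau. -/
noncomputable def stairE (n : ℕ) (α β : ℝ) (f : (ℕ → ℕ → StairSymb) → ℝ) : ℝ :=
  (∑ᶠ S ∈ {S : ℕ → ℕ → StairSymb | IsStaircase n S}, f S * stairWt α β S) / stairZ n α β

/-- Partial columns: nonempty entries lie in rows of `R` with index in `[1, m]`, and all entries
above an `α` are empty. -/
noncomputable def partialCols (R : Finset ℕ) : ℕ → Finset (ℕ → StairSymb)
  | 0 => {fun _ => StairSymb.empty}
  | m + 1 =>
    open Classical in
    if m + 1 ∈ R then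
      (partialCols R m ∪ (partialCols R m).image (fun c => Function.update c (m + 1) StairSymb.beta))
        ∪ {Function.update (fun _ => StairSymb.empty) (m + 1) StairSymb.alpha}
    else partialCols R m

/-- Columns with a nonempty entry in row `n + 1`, all other nonempty entries lying in `R`. -/
noncomputable def fullCols (R : Finset ℕ) (n : ℕ) : Finset (ℕ → StairSymb) :=
  open Classical in
  (partialCols R n).image (fun c => Function.update c (n + 1) StairSymb.beta)
    ∪ {Function.update (fun _ => StairSymb.empty) (n + 1) StairSymb.alpha}

theorem mem_partialCols (R : Finset ℕ) (m : ℕ) (c : ℕ → StairSymb) :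
    c ∈ partialCols R m ↔ (∀ i, c i ≠ StairSymb.empty → i ∈ R ∧ 1 ≤ i ∧ i ≤ m) ∧
      ∀ i i', i < i' → c i' = StairSymb.alpha → c i = StairSymb.empty := by
  induction m generalizing c with
  | zero =>
    simp only [partialCols, Finset.mem_singleton]
    constructor
    · rintro rfl; simp
    · rintro ⟨h, -⟩
      funext i
      by_contra hi
      have := h i hi
      omega
  | succ m ih =>
    by_cases hm : m + 1 ∈ R
    · simp only [partialCols, if_pos hm, Finset.mem_union, Finset.mem_image, Finset.mem_singleton]
      constructor
      · rintro ((h | ⟨d, h, rfl⟩) | rfl)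
        · obtain ⟨h1, h2⟩ := (ih c).1 h
          exact ⟨fun i hi => ⟨(h1 i hi).1, (h1 i hi).2.1, by have := (h1 i hi).2.2; omega⟩, h2⟩
        · obtain ⟨h1, h2⟩ := (ih d).1 h
          refine ⟨fun i hi => ?_, fun i i' hii hi' => ?_⟩
          · by_cases him : i = m + 1
            · subst him; exact ⟨hm, by omega, le_rfl⟩
            · rw [Function.update_of_ne him] at hi
              exact ⟨(h1 i hi).1, (h1 i hi).2.1, by have := (h1 i hi).2.2; omega⟩
          · by_cases him : i' = m + 1
            · subst him; simp at hi'
            · rw [Function.update_of_ne him] at hi'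
              have hle := (h1 i' (by simp [hi'])).2.2
              rw [Function.update_of_ne (by omega)]
              exact h2 i i' hii hi'
        · refine ⟨fun i hi => ?_, fun i i' hii hi' => ?_⟩
          · by_cases him : i = m + 1
            · subst him; exact ⟨hm, by omega, le_rfl⟩
            · simp [Function.update_of_ne him] at hi
          · by_cases him : i' = m + 1
            · rw [Function.update_of_ne (by omega)]
            · simp [Function.update_of_ne him] at hi'
      · rintro ⟨h1, h2⟩
        rcases hc : c (m + 1) with _ | _ | _
        · refine Or.inl (Or.inl ((ih c).2 ⟨fun i hi => ?_, h2⟩))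
          obtain ⟨h3, h4, h5⟩ := h1 i hi
          have : i ≠ m + 1 := by rintro rfl; exact hi hc
          exact ⟨h3, h4, by omega⟩
        · right
          funext i
          by_cases him : i = m + 1
          · subst him; simp [hc]
          · rw [Function.update_of_ne him]
            by_contra hi
            have := h1 i hi
            exact hi (h2 i (m + 1) (by omega) hc)
        · refine Or.inl (Or.inr ⟨Function.update c (m + 1) StairSymb.empty, (ih _).2 ⟨?_, ?_⟩, ?_⟩)
          · intro i hi
            by_cases him : i = m + 1
            · subst him; simp at hi
            · rw [Function.update_of_ne him] at hi
              obtain ⟨h3, h4, h5⟩ := h1 i hi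
              exact ⟨h3, h4, by omega⟩
          · intro i i' hii hi'
            by_cases him : i' = m + 1
            · subst him; simp at hi'
            · rw [Function.update_of_ne him] at hi'
              by_cases him : i = m + 1
              · subst him; simp
              · rw [Function.update_of_ne him]; exact h2 i i' hii hi'
          · rw [Function.update_idem, ← hc, Function.update_eq_self]
    · simp only [partialCols, if_neg hm]
      rw [ih]
      constructor
      · rintro ⟨h1, h2⟩
        exact ⟨fun i hi => ⟨(h1 i hi).1, (h1 i hi).2.1, by have := (h1 i hi).2.2; omega⟩, h2⟩
      · rintro ⟨h1, h2⟩
        refine ⟨fun i hi => ?_, h2⟩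
        obtain ⟨h3, h4, h5⟩ := h1 i hi
        have : i ≠ m + 1 := by rintro rfl; exact hm h3
        exact ⟨h3, h4, by omega⟩

theorem partialCols_apply_succ {R : Finset ℕ} {m : ℕ} {c : ℕ → StairSymb}
    (hc : c ∈ partialCols R m) : c (m + 1) = StairSymb.empty := by
  by_contra h
  have := (((mem_partialCols R m c).1 hc).1 _ h).2.2
  omega

theorem mem_fullCols (R : Finset ℕ) (n : ℕ) (c : ℕ → StairSymb) (hR : n + 1 ∉ R) :
    c ∈ fullCols R n ↔ (∀ i, c i ≠ StairSymb.empty → i ≠ n + 1 → i ∈ R ∧ 1 ≤ i ∧ i ≤ n) ∧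
      (∀ i i', i < i' → c i' = StairSymb.alpha → c i = StairSymb.empty) ∧
      c (n + 1) ≠ StairSymb.empty := by
  classical
  have key : c ∈ partialCols (insert (n + 1) R) (n + 1) ∧ c (n + 1) ≠ StairSymb.empty ↔
      c ∈ fullCols R n := by
    have hpc : partialCols (insert (n + 1) R) n = partialCols R n := by
      ext d
      simp only [mem_partialCols, Finset.mem_insert]
      refine and_congr_left fun _ => forall_congr' fun i => imp_congr_right fun _ => ?_
      constructor
      · rintro ⟨h | h, h1⟩
        · omega
        · exact ⟨h, h1⟩
      · rintro ⟨h, h1⟩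
        exact ⟨Or.inr h, h1⟩
    simp only [partialCols, fullCols, Finset.mem_insert_self, if_true, hpc, Finset.mem_union,
      Finset.mem_image, Finset.mem_singleton]
    constructor
    · rintro ⟨(h | h) | h, h1⟩
      · exact absurd (partialCols_apply_succ h) h1
      · exact Or.inl h
      · exact Or.inr h
    · rintro (⟨d, h, rfl⟩ | rfl)
      · exact ⟨Or.inl (Or.inr ⟨d, h, rfl⟩), by simp⟩
      · exact ⟨Or.inr rfl, by simp⟩
  rw [← key, mem_partialCols, and_assoc]
  refine and_congr_left fun _ => forall_congr' fun i => imp_congr_right fun _ => ?_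
  rw [Finset.mem_insert]
  grind

theorem update_injOn_partialCols (R : Finset ℕ) (m : ℕ) :
    Set.InjOn (fun c : ℕ → StairSymb => Function.update c (m + 1) StairSymb.beta)
      (partialCols R m) := by
  intro c hc d hd h
  funext i
  by_cases him : i = m + 1
  · subst him
    rw [partialCols_apply_succ hc, partialCols_apply_succ hd]
  · have := congrFun h i
    simpa [Function.update_of_ne him] using this

theorem sum_fullCols (R : Finset ℕ) (n : ℕ) (f : (ℕ → StairSymb) → ℝ) :
    ∑ c ∈ fullCols R n, f c =
      ∑ c ∈ partialCols R n, f (Function.update c (n + 1) StairSymb.beta) +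
        f (Function.update (fun _ => StairSymb.empty) (n + 1) StairSymb.alpha) := by
  classical
  rw [fullCols, Finset.sum_union, Finset.sum_image (update_injOn_partialCols R n),
    Finset.sum_singleton]
  rw [Finset.disjoint_singleton_right, Finset.mem_image]
  rintro ⟨c, -, h⟩
  simpa using congrFun h (n + 1)

theorem sum_partialCols_succ (R : Finset ℕ) (m : ℕ) (hm : m + 1 ∈ R) (f : (ℕ → StairSymb) → ℝ) :
    ∑ c ∈ partialCols R (m + 1), f c =
      ∑ c ∈ partialCols R m, f c +
        ∑ c ∈ partialCols R m, f (Function.update c (m + 1) StairSymb.beta) +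
        f (Function.update (fun _ => StairSymb.empty) (m + 1) StairSymb.alpha) := by
  classical
  rw [partialCols, if_pos hm, Finset.sum_union, Finset.sum_union,
    Finset.sum_image (update_injOn_partialCols R m), Finset.sum_singleton]
  · rw [Finset.disjoint_left]
    intro d hd hd'
    obtain ⟨c, -, rfl⟩ := Finset.mem_image.1 hd'
    simpa using partialCols_apply_succ hd
  · rw [Finset.disjoint_singleton_right, Finset.mem_union, Finset.mem_image]
    rintro (h | ⟨c, -, h⟩)
    · simpa using partialCols_apply_succ h
    · simpa using congrFun h (m + 1)

/-- The weight of a column. -/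
noncomputable def colWt (α β : ℝ) (c : ℕ → StairSymb) : ℝ :=
  α ^ Set.ncard {i | c i = StairSymb.alpha} * β ^ Set.ncard {i | c i = StairSymb.beta}

theorem colWt_update_beta (α β : ℝ) {R : Finset ℕ} {m : ℕ} {c : ℕ → StairSymb}
    (hc : c ∈ partialCols R m) :
    colWt α β (Function.update c (m + 1) StairSymb.beta) = β * colWt α β c := by
  have h0 := partialCols_apply_succ hc
  have ha : {i | Function.update c (m + 1) StairSymb.beta i = StairSymb.alpha} =
      {i | c i = StairSymb.alpha} := by
    ext i
    by_cases him : i = m + 1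
    · subst him; simp [h0]
    · simp [Function.update_of_ne him]
  have hb : {i | Function.update c (m + 1) StairSymb.beta i = StairSymb.beta} =
      insert (m + 1) {i | c i = StairSymb.beta} := by
    ext i
    by_cases him : i = m + 1
    · subst him; simp
    · simp [him]
  have hfin : {i | c i = StairSymb.beta}.Finite :=
    R.finite_toSet.subset fun i (hi : c i = _) =>
      (((mem_partialCols R m c).1 hc).1 i (by simp [hi])).1
  rw [colWt, colWt, ha, hb, Set.ncard_insert_of_notMem (by simp [h0]) hfin, pow_succ]
  ring

theorem colWt_empty (α β : ℝ) : colWt α β (fun _ => StairSymb.empty) = 1 := by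
  simp [colWt]

theorem colWt_single_alpha (α β : ℝ) (m : ℕ) :
    colWt α β (Function.update (fun _ => StairSymb.empty) m StairSymb.alpha) = α := by
  have ha : {i | Function.update (fun _ => StairSymb.empty) m StairSymb.alpha i
      = StairSymb.alpha} = {m} := by
    ext i
    by_cases him : i = m
    · subst him; simp
    · simp [him]
  have hb : {i | Function.update (fun _ => StairSymb.empty) m StairSymb.alpha i
      = StairSymb.beta} = ∅ := by
    ext i
    by_cases him : i = m
    · subst him; simp
    · simp [him]
  simp [colWt, ha, hb]

theorem sum_partialCols_colWt (α t : ℝ) (R : Finset ℕ) (m : ℕ) :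
    t * ∑ c ∈ partialCols R m, colWt α t c =
      (t + α) * (1 + t) ^ (R.filter (fun i => 1 ≤ i ∧ i ≤ m)).card - α := by
  induction m with
  | zero =>
    have : R.filter (fun i => 1 ≤ i ∧ i ≤ 0) = ∅ := by
      ext i; simp; omega
    rw [this]
    simp [partialCols, colWt_empty]
  | succ m ih =>
    by_cases hm : m + 1 ∈ R
    · have : R.filter (fun i => 1 ≤ i ∧ i ≤ m + 1) =
          insert (m + 1) (R.filter (fun i => 1 ≤ i ∧ i ≤ m)) := by
        ext i
        simp only [Finset.mem_filter, Finset.mem_insert]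
        grind
      rw [this, Finset.card_insert_of_notMem (by simp), sum_partialCols_succ R m hm,
        Finset.sum_congr rfl (fun c hc => colWt_update_beta α t hc), ← Finset.mul_sum,
        colWt_single_alpha, pow_succ]
      linear_combination (1 + t) * ih
    · have : R.filter (fun i => 1 ≤ i ∧ i ≤ m + 1) = R.filter (fun i => 1 ≤ i ∧ i ≤ m) := by
        ext i
        simp only [Finset.mem_filter]
        grind
      rw [this, partialCols, if_neg hm, ih]

theorem sum_fullCols_colWt (α t : ℝ) (R : Finset ℕ) (n : ℕ) (hR : R ⊆ Finset.Icc 1 n) :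
    ∑ c ∈ fullCols R n, colWt α t c = (t + α) * (1 + t) ^ R.card := by
  have : R.filter (fun i => 1 ≤ i ∧ i ≤ n) = R :=
    Finset.filter_true_of_mem fun i hi => Finset.mem_Icc.1 (hR hi)
  have h := sum_partialCols_colWt α t R n
  rw [this] at h
  rw [sum_fullCols, Finset.sum_congr rfl (fun c hc => colWt_update_beta α t hc), ← Finset.mul_sum,
    h, colWt_single_alpha]
  ring

/-- Prepend a column to a tableau. -/
def consCol (c : ℕ → StairSymb) (S : ℕ → ℕ → StairSymb) : ℕ → ℕ → StairSymb
  | _, 0 => StairSymb.empty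
  | i, 1 => c i
  | i, j + 2 => S i (j + 1)

/-- Remove the first column of a tableau. -/
def tailCol (S : ℕ → ℕ → StairSymb) : ℕ → ℕ → StairSymb
  | _, 0 => StairSymb.empty
  | i, j + 1 => S i (j + 2)

theorem tailCol_consCol (c : ℕ → StairSymb) {S : ℕ → ℕ → StairSymb}
    (hS : ∀ i, S i 0 = StairSymb.empty) : tailCol (consCol c S) = S := by
  funext i j
  cases j <;> simp [tailCol, consCol, hS]

theorem consCol_tailCol {S : ℕ → ℕ → StairSymb} (hS : ∀ i, S i 0 = StairSymb.empty) :
    consCol (fun i => S i 1) (tailCol S) = S := by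
  funext i j
  rcases j with _ | _ | j <;> simp [tailCol, consCol, hS]

theorem tailCol_apply (S : ℕ → ℕ → StairSymb) (i : ℕ) {j : ℕ} (hj : 1 ≤ j) :
    tailCol S i j = S i (j + 1) := by
  obtain ⟨j, rfl⟩ := Nat.exists_eq_add_of_le' hj
  rfl

open Classical in
/-- The rows in `[1, n]` that contain no `β`. -/
noncomputable def freeRows (n : ℕ) (S : ℕ → ℕ → StairSymb) : Finset ℕ :=
  (Finset.Icc 1 n).filter fun i => ∀ j, S i j ≠ StairSymb.beta

theorem freeRows_subset (n : ℕ) (S : ℕ → ℕ → StairSymb) : freeRows n S ⊆ Finset.Icc 1 n :=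
  open Classical in Finset.filter_subset _ _

theorem succ_notMem_freeRows (n : ℕ) (S : ℕ → ℕ → StairSymb) : n + 1 ∉ freeRows n S := by
  simp [freeRows]

theorem IsStaircase.apply_zero {n : ℕ} {S : ℕ → ℕ → StairSymb} (h : IsStaircase n S) (i : ℕ) :
    S i 0 = StairSymb.empty := h.1 i 0 (by omega)

theorem IsStaircase.box {n : ℕ} {S : ℕ → ℕ → StairSymb} (h : IsStaircase n S) {i j : ℕ}
    (hij : S i j ≠ StairSymb.empty) : 1 ≤ i ∧ 1 ≤ j ∧ i + j ≤ n + 1 := by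
  by_contra h'
  exact hij (h.1 i j h')

theorem isStaircase_consCol (n : ℕ) (c : ℕ → StairSymb) (S : ℕ → ℕ → StairSymb)
    (hS : ∀ i, S i 0 = StairSymb.empty) :
    IsStaircase (n + 1) (consCol c S) ↔ IsStaircase n S ∧ c ∈ fullCols (freeRows n S) n := by
  rw [mem_fullCols _ _ _ (succ_notMem_freeRows n S)]
  constructor
  · intro h
    have hs : ∀ i j, 1 ≤ j → consCol c S i (j + 1) = S i j := by
      intro i j hj
      obtain ⟨j, rfl⟩ := Nat.exists_eq_add_of_le' hj
      rfl
    have hc : ∀ i, consCol c S i 1 = c i := fun i => rfl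
    have hS' : IsStaircase n S := by
      refine ⟨fun i j hij => ?_, fun i i' j h1 h2 h3 h4 h5 => ?_,
        fun i j j' h1 h2 h3 h4 h5 => ?_, fun i j h1 h2 h3 => ?_⟩
      · rcases Nat.eq_zero_or_pos j with rfl | hj
        · exact hS i
        · rw [← hs i j hj]; exact h.1 _ _ (by omega)
      · rw [← hs i j h3]
        exact h.2.1 i i' (j + 1) h1 h2 (by omega) (by omega) (by rw [hs _ _ h3]; exact h5)
      · rw [← hs i j h2]
        exact h.2.2.1 i (j + 1) (j' + 1) h1 (by omega) (by omega) (by omega)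
          (by rw [hs _ _ (by omega)]; exact h5)
      · rw [← hs i j h2]
        exact h.2.2.2 i (j + 1) h1 (by omega) (by omega)
    refine ⟨hS', fun i hi hin => ?_, fun i i' hii hi' => ?_, ?_⟩
    · have hb := h.box (i := i) (j := 1) hi
      have : i ≤ n := by omega
      refine ⟨?_, hb.1, this⟩
      simp only [freeRows, Finset.mem_filter, Finset.mem_Icc]
      refine ⟨⟨hb.1, this⟩, fun j hj => hi ?_⟩
      have hb' := hS'.box (i := i) (j := j) (by simp [hj])
      exact h.2.2.1 i 1 (j + 1) hb.1 le_rfl (by omega) (by omega) (by rw [hs _ _ hb'.2.1]; exact hj)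
    · have hb := h.box (i := i') (j := 1) (by rw [hc, hi']; simp)
      rcases Nat.eq_zero_or_pos i with rfl | hpos
      · exact h.1 0 1 (by omega)
      · exact h.2.1 i i' 1 hpos hii le_rfl hb.2.2 hi'
    · exact h.2.2.2 (n + 1) 1 (by omega) le_rfl rfl
  · rintro ⟨h, h1, h2, h3⟩
    refine ⟨fun i j hij => ?_, fun i i' j hi hii hj hij hα => ?_,
      fun i j j' hi hj hjj hij hβ => ?_, fun i j hi hj hij => ?_⟩
    · rcases j with _ | _ | j
      · rfl
      · by_contra hne
        have := h1 i hne (by omega)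
        omega
      · exact h.1 _ _ (by omega)
    · rcases j with _ | _ | j
      · rfl
      · exact h2 i i' hii hα
      · exact h.2.1 i i' (j + 1) hi hii (by omega) (by omega) hα
    · rcases j' with _ | _ | j'
      · omega
      · omega
      · rcases j with _ | _ | j
        · rfl
        · by_contra hne
          have hm := (h1 i hne (by omega)).1
          simp only [freeRows, Finset.mem_filter] at hm
          exact hm.2 (j' + 1) hβ
        · exact h.2.2.1 i (j + 1) (j' + 1) hi (by omega) (by omega) (by omega) hβ
    · rcases j with _ | _ | j
      · omega
      · obtain rfl : i = n + 1 := by omega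
        exact h3
      · exact h.2.2.2 i (j + 1) hi (by omega) (by omega)

/-- The finite set of staircase tableaux of size `n`. -/
noncomputable def tableaux : ℕ → Finset (ℕ → ℕ → StairSymb)
  | 0 => {fun _ _ => StairSymb.empty}
  | n + 1 =>
    open Classical in
    (tableaux n).biUnion fun S => (fullCols (freeRows n S) n).image fun c => consCol c S

theorem mem_tableaux (n : ℕ) (S : ℕ → ℕ → StairSymb) : S ∈ tableaux n ↔ IsStaircase n S := by
  induction n generalizing S with
  | zero =>
    rw [tableaux, Finset.mem_singleton]
    constructor
    · rintro rfl
      exact ⟨by simp, by simp, by simp, by intros; omega⟩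
    · intro h
      funext i j
      exact h.1 i j (by omega)
  | succ n ih =>
    simp only [tableaux, Finset.mem_biUnion, Finset.mem_image]
    constructor
    · rintro ⟨S', hS', c, hc, rfl⟩
      rw [ih] at hS'
      exact (isStaircase_consCol n c S' hS'.apply_zero).2 ⟨hS', hc⟩
    · intro h
      have h' := h
      rw [← consCol_tailCol h.apply_zero, isStaircase_consCol n _ _ (fun _ => rfl)] at h'
      exact ⟨tailCol S, (ih _).2 h'.1, _, h'.2, consCol_tailCol h.apply_zero⟩

theorem apply_zero_of_mem_tableaux {n : ℕ} {S : ℕ → ℕ → StairSymb} (h : S ∈ tableaux n) (i : ℕ) :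
    S i 0 = StairSymb.empty := ((mem_tableaux n S).1 h).apply_zero i

theorem sum_tableaux_succ (n : ℕ) (f : (ℕ → ℕ → StairSymb) → ℝ) :
    ∑ S ∈ tableaux (n + 1), f S =
      ∑ S ∈ tableaux n, ∑ c ∈ fullCols (freeRows n S) n, f (consCol c S) := by
  classical
  rw [tableaux, Finset.sum_biUnion]
  · refine Finset.sum_congr rfl fun S _ => Finset.sum_image ?_
    intro c _ d _ h
    funext i
    exact congrFun (congrFun h i) 1
  · intro S hS S' hS' hne
    rw [Function.onFun, Finset.disjoint_left]
    intro T hT hT'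
    obtain ⟨c, -, rfl⟩ := Finset.mem_image.1 hT
    obtain ⟨d, -, h⟩ := Finset.mem_image.1 hT'
    apply hne
    rw [← tailCol_consCol c (apply_zero_of_mem_tableaux hS), ← h,
      tailCol_consCol d (apply_zero_of_mem_tableaux hS')]

theorem IsStaircase.finite_setOf_eq {n : ℕ} {S : ℕ → ℕ → StairSymb} (h : IsStaircase n S)
    {s : StairSymb} (hs : s ≠ StairSymb.empty) : {p : ℕ × ℕ | S p.1 p.2 = s}.Finite := by
  refine (Finset.finite_toSet (Finset.Icc 1 (n + 1) ×ˢ Finset.Icc 1 (n + 1))).subset ?_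
  rintro ⟨i, j⟩ (hij : S i j = s)
  have := h.box (hij.trans_ne hs)
  simp only [Finset.coe_product, Finset.coe_Icc, Set.mem_prod, Set.mem_Icc]
  omega

theorem ncard_consCol {n : ℕ} {c : ℕ → StairSymb} {S : ℕ → ℕ → StairSymb}
    (hS : IsStaircase n S) (hc : c ∈ fullCols (freeRows n S) n)
    {s : StairSymb} (hs : s ≠ StairSymb.empty) :
    Set.ncard {p : ℕ × ℕ | consCol c S p.1 p.2 = s} =
      Set.ncard {i | c i = s} + Set.ncard {p : ℕ × ℕ | S p.1 p.2 = s} := by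
  have hfin := ((isStaircase_consCol n c S hS.apply_zero).2 ⟨hS, hc⟩).finite_setOf_eq hs
  have h : {p : ℕ × ℕ | consCol c S p.1 p.2 = s} =
      (fun i => (i, 1)) '' {i | c i = s} ∪
        (fun p : ℕ × ℕ => (p.1, p.2 + 1)) '' {p : ℕ × ℕ | S p.1 p.2 = s} := by
    ext ⟨i, j⟩
    rcases j with _ | _ | j
    · simp [consCol, hs.symm]
    · simp only [Set.mem_ofPred_eq, Set.mem_union, Set.mem_image, Prod.mk.injEq]
      constructor
      · intro h
        exact Or.inl ⟨i, h, rfl, by simp⟩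
      · rintro (⟨i', h, rfl, -⟩ | ⟨⟨i', j'⟩, h, rfl, h'⟩)
        · exact h
        · obtain rfl : j' = 0 := by simpa using h'
          exact absurd ((hS.apply_zero i').symm.trans h) hs.symm
    · simp [consCol]
  rw [h] at hfin ⊢
  rw [Set.ncard_union_eq _ (hfin.subset Set.subset_union_left) (hfin.subset Set.subset_union_right),
    Set.ncard_image_of_injective _ (fun _ _ h => (Prod.mk.inj h).1),
    Set.ncard_image_of_injective]
  · rintro ⟨i, j⟩ ⟨i', j'⟩ h
    simpa using h
  · rw [Set.disjoint_left]
    rintro _ ⟨i, -, rfl⟩ ⟨⟨i', j'⟩, h', h⟩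
    obtain rfl : j' = 0 := by simpa using (Prod.mk.inj h).2
    exact hs ((hS.apply_zero i').symm.trans h').symm

theorem stairWt_consCol (α β : ℝ) {n : ℕ} {c : ℕ → StairSymb} {S : ℕ → ℕ → StairSymb}
    (hS : IsStaircase n S) (hc : c ∈ fullCols (freeRows n S) n) :
    stairWt α β (consCol c S) = colWt α β c * stairWt α β S := by
  rw [stairWt, stairWt, colWt, ncard_consCol hS hc (by simp), ncard_consCol hS hc (by simp),
    pow_add, pow_add]
  ring

theorem card_freeRows_consCol {n : ℕ} {c : ℕ → StairSymb} {S : ℕ → ℕ → StairSymb}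
    (hS : IsStaircase n S) (hc : c ∈ fullCols (freeRows n S) n) :
    (freeRows (n + 1) (consCol c S)).card + Set.ncard {i | c i = StairSymb.beta} =
      (freeRows n S).card + 1 := by
  classical
  have hc' := (mem_fullCols _ _ _ (succ_notMem_freeRows n S)).1 hc
  have h1 : {i | c i = StairSymb.beta} =
      ((insert (n + 1) (freeRows n S)).filter (fun i => c i = StairSymb.beta) : Finset ℕ) := by
    ext i
    simp only [Set.mem_ofPred_eq, Finset.coe_filter, Finset.mem_insert]
    constructor
    · intro h
      refine ⟨?_, h⟩
      by_cases hi : i = n + 1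
      · exact Or.inl hi
      · exact Or.inr (hc'.1 i (by simp [h]) hi).1
    · exact And.right
  have h2 : freeRows (n + 1) (consCol c S) =
      (insert (n + 1) (freeRows n S)).filter (fun i => ¬ c i = StairSymb.beta) := by
    ext i
    simp only [freeRows, Finset.mem_filter, Finset.mem_insert, Finset.mem_Icc]
    constructor
    · rintro ⟨hi, h⟩
      refine ⟨?_, h 1⟩
      by_cases hin : i = n + 1
      · exact Or.inl hin
      · refine Or.inr ⟨by omega, fun j => ?_⟩
        rcases j with _ | j
        · simp [hS.apply_zero]
        · exact h (j + 2)
    · rintro ⟨h, hb⟩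
      refine ⟨by omega, fun j => ?_⟩
      rcases j with _ | _ | j
      · simp [consCol]
      · exact hb
      · rcases h with rfl | h
        · intro hbeta
          have := hS.box (i := n + 1) (j := j + 1) (by
            change S (n + 1) (j + 1) = StairSymb.beta at hbeta
            simp [hbeta])
          omega
        · exact h.2 (j + 1)
  rw [h1, h2, Set.ncard_coe_finset, add_comm, Finset.card_filter_add_card_filter_not,
    Finset.card_insert_of_notMem (succ_notMem_freeRows n S)]

/-- The weight of a tableau refined by the number of rows without `β`. -/
noncomputable def refWt (n : ℕ) (α β x : ℝ) (S : ℕ → ℕ → StairSymb) : ℝ :=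
  stairWt α β S * x ^ (freeRows n S).card

theorem refWt_consCol (α β : ℝ) {x : ℝ} (hx : x ≠ 0) {n : ℕ} {c : ℕ → StairSymb}
    {S : ℕ → ℕ → StairSymb} (hS : IsStaircase n S) (hc : c ∈ fullCols (freeRows n S) n) :
    refWt (n + 1) α β x (consCol c S) = x * refWt n α β x S * colWt α (β / x) c := by
  have h : x ^ (freeRows (n + 1) (consCol c S)).card * x ^ Set.ncard {i | c i = StairSymb.beta} =
      x ^ (freeRows n S).card * x := by
    rw [← pow_add, card_freeRows_consCol hS hc, pow_succ]
  have hx' : x ^ Set.ncard {i | c i = StairSymb.beta} ≠ 0 := pow_ne_zero _ hx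
  rw [refWt, refWt, stairWt_consCol α β hS hc, colWt, colWt, div_pow]
  field_simp
  linear_combination α ^ Set.ncard {i | c i = StairSymb.alpha} *
    β ^ Set.ncard {i | c i = StairSymb.beta} * stairWt α β S * h

open Classical in
/-- The generating function, in the number of rows without `β`, of the tableaux of size `n`
satisfying `P`. -/
noncomputable def genFun (n : ℕ) (α β x : ℝ) (P : (ℕ → ℕ → StairSymb) → Prop) : ℝ :=
  ∑ S ∈ tableaux n, if P S then refWt n α β x S else 0

theorem genFun_congr {n : ℕ} (α β x : ℝ) {P Q : (ℕ → ℕ → StairSymb) → Prop}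
    (h : ∀ S, P S ↔ Q S) : genFun n α β x P = genFun n α β x Q := by
  have : P = Q := funext fun S => propext (h S)
  rw [this]

theorem genFun_zero (α β x : ℝ) {P : (ℕ → ℕ → StairSymb) → Prop} (hP : ∀ S, P S) :
    genFun 0 α β x P = 1 := by
  simp [genFun, tableaux, hP, refWt, stairWt, freeRows]

theorem genFun_succ_tailCol (n : ℕ) (α β : ℝ) {x : ℝ} (hx : x ≠ 0)
    (P : (ℕ → ℕ → StairSymb) → Prop) :
    genFun (n + 1) α β x (fun S => P (tailCol S)) = (α * x + β) * genFun n α β (x + β) P := by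
  classical
  rw [genFun, sum_tableaux_succ, genFun, Finset.mul_sum]
  refine Finset.sum_congr rfl fun S hS => ?_
  by_cases hP : P S
  · have hS' := (mem_tableaux n S).1 hS
    simp only [tailCol_consCol _ (apply_zero_of_mem_tableaux hS), if_pos hP]
    rw [Finset.sum_congr rfl (fun c hc => refWt_consCol α β hx hS' hc), ← Finset.mul_sum,
      sum_fullCols_colWt _ _ _ _ (freeRows_subset n S), refWt, refWt]
    have h1 : x ^ (freeRows n S).card * (1 + β / x) ^ (freeRows n S).card =
        (x + β) ^ (freeRows n S).card := by
      rw [← mul_pow]; congr 1; field_simp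
    have h2 : x * (β / x + α) = α * x + β := by field_simp; ring
    rw [← h1, ← h2]
    ring
  · simp [tailCol_consCol _ (apply_zero_of_mem_tableaux hS), hP]

theorem genFun_succ_free (n : ℕ) (α β : ℝ) {x : ℝ} (hx : x ≠ 0)
    (P : (ℕ → ℕ → StairSymb) → Prop) :
    genFun (n + 1) α β x (fun S => n + 1 ∈ freeRows (n + 1) S ∧ P (tailCol S)) =
      α * x * genFun n α β x P := by
  classical
  rw [genFun, sum_tableaux_succ, genFun, Finset.mul_sum]
  refine Finset.sum_congr rfl fun S hS => ?_
  have hS' := (mem_tableaux n S).1 hS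
  have hmem : ∀ c, n + 1 ∈ freeRows (n + 1) (consCol c S) ↔ c (n + 1) ≠ StairSymb.beta := by
    intro c
    simp only [freeRows, Finset.mem_filter, Finset.mem_Icc]
    constructor
    · exact fun h => h.2 1
    · refine fun h => ⟨by omega, fun j => ?_⟩
      rcases j with _ | _ | j
      · simp [consCol]
      · exact h
      · intro hb
        have := hS'.box (i := n + 1) (j := j + 1) (by
          change S (n + 1) (j + 1) = StairSymb.beta at hb
          simp [hb])
        omega
  simp only [tailCol_consCol _ (apply_zero_of_mem_tableaux hS), hmem]
  rw [sum_fullCols, refWt_consCol α β hx hS' (by simp [fullCols]), colWt_single_alpha]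
  simp only [Function.update_self, ne_eq, not_true_eq_false, false_and, if_false,
    Finset.sum_const_zero, zero_add, reduceCtorEq, not_false_eq_true, true_and]
  split_ifs <;> ring

theorem genFun_succ_alpha (n : ℕ) (α β : ℝ) {x : ℝ} (hx : x ≠ 0)
    (P : (ℕ → ℕ → StairSymb) → Prop) :
    genFun (n + 2) α β x (fun S => S (n + 1) 1 = StairSymb.alpha ∧ P (tailCol S)) =
      α * β * genFun (n + 1) α β x (fun S => n + 1 ∈ freeRows (n + 1) S ∧ P S) := by
  classical
  rw [genFun, sum_tableaux_succ, genFun, Finset.mul_sum]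
  refine Finset.sum_congr rfl fun S hS => ?_
  have hS' := (mem_tableaux _ S).1 hS
  have happ : ∀ c, consCol c S (n + 1) 1 = c (n + 1) := fun _ => rfl
  simp only [tailCol_consCol _ (apply_zero_of_mem_tableaux hS), happ]
  rw [sum_fullCols]
  have hne : n + 1 ≠ n + 1 + 1 := by omega
  simp only [Function.update_of_ne hne, reduceCtorEq, false_and, if_false, add_zero]
  by_cases hfree : n + 1 ∈ freeRows (n + 1) S
  · rw [sum_partialCols_succ _ _ hfree, Finset.sum_eq_zero, Finset.sum_eq_zero]
    · simp only [Function.update_self, true_and, zero_add, hfree]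
      have hmem : Function.update (fun _ => StairSymb.empty) (n + 1) StairSymb.alpha ∈
          partialCols (freeRows (n + 1) S) (n + 1) := by
        simp [partialCols, hfree]
      rw [refWt_consCol α β hx hS' (by
          rw [fullCols]
          exact Finset.mem_union_left _ (Finset.mem_image_of_mem _ hmem)),
        colWt_update_beta _ _ hmem, colWt_single_alpha]
      split_ifs
      · field_simp
      · simp
    · intro c _
      simp
    · intro c hc
      simp [partialCols_apply_succ hc]
  · rw [Finset.sum_eq_zero]
    · simp [hfree]
    · intro c hc
      have : c (n + 1) = StairSymb.empty := by
        by_contra h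
        exact hfree (((mem_partialCols _ _ c).1 hc).1 _ h).1
      simp [this]

theorem two_mul_add_one_le {r : ℕ} {j : Fin r → ℕ} (hj1 : ∀ l, 1 ≤ j l)
    (hgap : ∀ l : Fin r, ∀ h : (l : ℕ) + 1 < r, j l + 2 ≤ j ⟨(l : ℕ) + 1, h⟩) (k : ℕ)
    (hk : k < r) : 2 * k + 1 ≤ j ⟨k, hk⟩ := by
  induction k with
  | zero => exact hj1 _
  | succ k ih =>
    have := hgap ⟨k, by omega⟩ hk
    have := ih (by omega)
    simp only at *
    omega

theorem two_mul_le {n r : ℕ} {j : Fin r → ℕ} (hj1 : ∀ l, 1 ≤ j l) (hjn : ∀ l, j l + 1 ≤ n)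
    (hgap : ∀ l : Fin r, ∀ h : (l : ℕ) + 1 < r, j l + 2 ≤ j ⟨(l : ℕ) + 1, h⟩) : 2 * r ≤ n := by
  rcases r with _ | r
  · omega
  · have h1 := two_mul_add_one_le hj1 hgap r (by omega)
    have h2 := hjn ⟨r, by omega⟩
    omega

theorem genFun_alphas {α β : ℝ} (hα : 0 < α) (hβ : 0 < β) (n r : ℕ) (j : Fin r → ℕ)
    (hj1 : ∀ l, 1 ≤ j l) (hjn : ∀ l, j l + 1 ≤ n)
    (hgap : ∀ l : Fin r, ∀ h : (l : ℕ) + 1 < r, j l + 2 ≤ j ⟨(l : ℕ) + 1, h⟩)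
    (y : ℝ) (hy : 0 < y) :
    genFun n α β (β * y) (fun S => ∀ l, S (n - j l) (j l) = StairSymb.alpha) =
      (α * β) ^ n * (∏ l : Fin r, (y + (j l : ℝ) - 2 * ((l : ℕ) + 1 : ℝ) + 1)) *
        ∏ i ∈ Finset.range (n - 2 * r), (y + 1 / α + i) := by
  induction n using Nat.strong_induction_on generalizing r j y with
  | _ n ih =>
  have hx : β * y ≠ 0 := by positivity
  by_cases h2 : ∀ l, 2 ≤ j l
  · rcases n with _ | n
    · rcases r with _ | r
      · rw [genFun_zero _ _ _ (by simp)]; simp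
      · have := hjn 0
        omega
    · have hgap' : ∀ l : Fin r, ∀ h : (l : ℕ) + 1 < r,
          j l - 1 + 2 ≤ j ⟨(l : ℕ) + 1, h⟩ - 1 := by
        intro l h
        have := hgap l h
        have := h2 l
        omega
      have hj1' : ∀ l, 1 ≤ j l - 1 := fun l => by have := h2 l; omega
      have hjn' : ∀ l, j l - 1 + 1 ≤ n := fun l => by have := h2 l; have := hjn l; omega
      have hr := two_mul_le hj1' hjn' hgap'
      have key := ih n (by omega) r (fun l => j l - 1) hj1' hjn' hgap' (y + 1) (by linarith)
      let P (S : ℕ → ℕ → StairSymb) : Prop :=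
        ∀ l, S (n - (j l - 1)) (j l - 1) = StairSymb.alpha
      rw [genFun_congr (Q := fun S => P (tailCol S)), genFun_succ_tailCol n α β hx P,
        show β * y + β = β * (y + 1) by ring, key,
        show n + 1 - 2 * r = (n - 2 * r) + 1 by omega, Finset.prod_range_succ']
      · have e1 : ∏ l : Fin r, (y + 1 + ((j l - 1 : ℕ) : ℝ) - 2 * ((l : ℕ) + 1 : ℝ) + 1) =
            ∏ l : Fin r, (y + (j l : ℝ) - 2 * ((l : ℕ) + 1 : ℝ) + 1) := by
          refine Finset.prod_congr rfl fun l _ => ?_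
          rw [Nat.cast_sub (hj1 l)]; push_cast; ring
        have e2 : ∏ i ∈ Finset.range (n - 2 * r), (y + 1 + 1 / α + (i : ℝ)) =
            ∏ i ∈ Finset.range (n - 2 * r), (y + 1 / α + ((i + 1 : ℕ) : ℝ)) := by
          refine Finset.prod_congr rfl fun i _ => ?_
          push_cast; ring
        have e3 : α * (β * y) + β = α * β * (y + 1 / α + ((0 : ℕ) : ℝ)) := by
          push_cast; field_simp; ring
        rw [e1, e2, e3]
        ring
      · intro S
        refine forall_congr' fun l => ?_
        rw [tailCol_apply _ _ (hj1' l), show n - (j l - 1) = n + 1 - j l by have := h2 l; omega,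
          show j l - 1 + 1 = j l by have := h2 l; omega]
  · push Not at h2
    obtain ⟨l₀, hl₀⟩ := h2
    rcases r with _ | r
    · exact l₀.elim0
    have hz : j 0 = 1 := by
      have h3 := two_mul_add_one_le hj1 hgap l₀ l₀.2
      have h4 : l₀ = 0 := Fin.ext (by simp only [Fin.eta] at h3; simp only [Fin.val_zero]; omega)
      have := hj1 0
      rw [h4] at hl₀
      omega
    have hr := two_mul_le hj1 hjn hgap
    obtain ⟨n, rfl⟩ : ∃ m, n = m + 2 := ⟨n - 2, by omega⟩
    have h3 : ∀ l : Fin r, 3 ≤ j l.succ := fun l => by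
      have := two_mul_add_one_le hj1 hgap (l + 1) (by omega)
      change 2 * ((l : ℕ) + 1) + 1 ≤ j l.succ at this
      omega
    have hgap' : ∀ l : Fin r, ∀ h : (l : ℕ) + 1 < r,
        j l.succ - 2 + 2 ≤ j (Fin.succ ⟨(l : ℕ) + 1, h⟩) - 2 := by
      intro l h
      have h4 := hgap l.succ (by simpa using h)
      have h5 := h3 l
      change j l.succ + 2 ≤ j (Fin.succ ⟨(l : ℕ) + 1, h⟩) at h4
      omega
    have hj1' : ∀ l : Fin r, 1 ≤ j l.succ - 2 := fun l => by have := h3 l; omega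
    have hjn' : ∀ l : Fin r, j l.succ - 2 + 1 ≤ n := fun l => by
      have := h3 l; have := hjn l.succ; omega
    have key := ih n (by omega) r (fun l => j l.succ - 2) hj1' hjn' hgap' y hy
    let P (S : ℕ → ℕ → StairSymb) : Prop :=
      ∀ l : Fin r, S (n - (j l.succ - 2)) (j l.succ - 2) = StairSymb.alpha
    rw [genFun_congr (Q := fun S => S (n + 1) 1 = StairSymb.alpha ∧ P (tailCol (tailCol S))),
      genFun_succ_alpha n α β hx (fun S => P (tailCol S)), genFun_succ_free n α β hx P, key,
      Fin.prod_univ_succ, hz, show n + 2 - 2 * (r + 1) = n - 2 * r by omega]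
    · have e1 : ∏ l : Fin r, (y + ((j l.succ - 2 : ℕ) : ℝ) - 2 * ((l : ℕ) + 1 : ℝ) + 1) =
          ∏ l : Fin r, (y + (j l.succ : ℝ) - 2 * (((l.succ : Fin (r + 1)) : ℕ) + 1 : ℝ) + 1) := by
        refine Finset.prod_congr rfl fun l _ => ?_
        rw [Nat.cast_sub (by have := h3 l; omega), Fin.val_succ]; push_cast; ring
      rw [e1, Fin.val_zero]
      push_cast
      ring
    · intro S
      rw [Fin.forall_fin_succ, hz]
      refine and_congr Iff.rfl (forall_congr' fun l => ?_)
      have := h3 l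
      rw [tailCol_apply _ _ (hj1' l), tailCol_apply _ _ (by omega),
        show n - (j l.succ - 2) = n + 2 - j l.succ by omega,
        show j l.succ - 2 + 1 + 1 = j l.succ by omega]

theorem finsum_stairWt_eq_genFun (n : ℕ) (α β : ℝ) (P : (ℕ → ℕ → StairSymb) → Prop) :
    ∑ᶠ S ∈ {S : ℕ → ℕ → StairSymb | IsStaircase n S ∧ P S}, stairWt α β S =
      genFun n α β 1 P := by
  classical
  have h : {S : ℕ → ℕ → StairSymb | IsStaircase n S ∧ P S} = ((tableaux n).filter P : Finset _) := by
    ext S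
    simp [mem_tableaux]
  rw [h, finsum_mem_coe_finset, Finset.sum_filter, genFun]
  simp [refWt]

theorem stairZ_eq (n : ℕ) {α β : ℝ} (hα : 0 < α) (hβ : 0 < β) :
    stairZ n α β = (α * β) ^ n * ∏ i ∈ Finset.range n, (1 / β + 1 / α + i) := by
  have h := genFun_alphas hα hβ n 0 Fin.elim0 (fun l => l.elim0) (fun l => l.elim0)
    (fun l => l.elim0) (1 / β) (by positivity)
  rw [mul_one_div_cancel hβ.ne', ← finsum_stairWt_eq_genFun] at h
  simpa [stairZ] using h

theorem prod_range_eq_prod_pairs (z : ℝ) (n r : ℕ) (h : 2 * r ≤ n) :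
    ∏ i ∈ Finset.range n, (z + i) = (∏ i ∈ Finset.range (n - 2 * r), (z + i)) *
      ∏ l ∈ Finset.range r, ((n + z - 2 * ((l : ℝ) + 1) + 1) * (n + z - 2 * ((l : ℝ) + 1))) := by
  induction r with
  | zero => simp
  | succ r ih =>
    rw [ih (by omega), Finset.prod_range_succ _ r,
      show n - 2 * r = (n - 2 * (r + 1)) + 1 + 1 by omega, Finset.prod_range_succ,
      Finset.prod_range_succ]
    push_cast [Nat.cast_sub h]
    ring

/-- Joint distribution of α's on the second main diagonal (Theorem on `αⱼ`'s):
if the columns `j_1 < ⋯ < j_r` have consecutive gaps `≥ 2`, then the probability that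
each box `(n − j_l, j_l)` contains α is the stated product. -/
theorem alphas_on_second_diagonal (n : ℕ) (hn : 1 ≤ n) (α β : ℝ) (hα : 0 < α) (hβ : 0 < β)
    (r : ℕ) (hr : 1 ≤ r) (j : Fin r → ℕ)
    (hj1 : ∀ l, 1 ≤ j l) (hjn : ∀ l, j l ≤ n - 1) (hmono : StrictMono j)
    (hgap : ∀ l : Fin r, ∀ h : (l : ℕ) + 1 < r, j l + 2 ≤ j ⟨(l : ℕ) + 1, h⟩) :
    stairP n α β (fun S => ∀ l : Fin r, S (n - j l) (j l) = StairSymb.alpha)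
      = ∏ l : Fin r,
          (1/β + (j l : ℝ) - 2 * ((l : ℕ) + 1 : ℝ) + 1) /
            (((n : ℝ) + 1/α + 1/β - 2 * ((l : ℕ) + 1 : ℝ) + 1) *
              ((n : ℝ) + 1/α + 1/β - 2 * ((l : ℕ) + 1 : ℝ))) := by
  have hjn' : ∀ l, j l + 1 ≤ n := fun l => by have := hjn l; omega
  have h2r := two_mul_le hj1 hjn' hgap
  have hG := genFun_alphas hα hβ n r j hj1 hjn' hgap (1 / β) (by positivity)
  rw [mul_one_div_cancel hβ.ne'] at hG
  have hP : ∏ l : Fin r, (((n : ℝ) + 1/α + 1/β - 2 * ((l : ℕ) + 1 : ℝ) + 1) *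
      ((n : ℝ) + 1/α + 1/β - 2 * ((l : ℕ) + 1 : ℝ))) =
      ∏ l ∈ Finset.range r, ((n + (1 / β + 1 / α) - 2 * ((l : ℝ) + 1) + 1) *
        (n + (1 / β + 1 / α) - 2 * ((l : ℝ) + 1))) := by
    rw [Finset.prod_range]
    refine Finset.prod_congr rfl fun l _ => ?_
    ring
  have hpos : ∀ m : ℕ, 0 < ∏ i ∈ Finset.range m, (1 / β + 1 / α + (i : ℝ)) := fun m =>
    Finset.prod_pos fun i _ => by positivity
  have hsplit := prod_range_eq_prod_pairs (1 / β + 1 / α) n r h2r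
  have hn0 := (hpos n).ne'
  rw [stairP, finsum_stairWt_eq_genFun, hG, stairZ_eq n hα hβ, Finset.prod_div_distrib, hP]
  rw [hsplit] at hn0 ⊢
  have h1 := left_ne_zero_of_mul hn0
  have h2 := right_ne_zero_of_mul hn0
  have h3 : (α * β) ^ n ≠ 0 := by positivity
  rw [div_eq_div_iff (mul_ne_zero h3 hn0) h2]
  ring
end

section
/- Fix α, β ∈ (0, ∞). For every integer r ≥ 1, the r-th factorial moment of A_n converges to (1/2)^r as n → ∞; that is, E_{n,α,β}[A_n(A_n−1)⋯(A_n−r+1)] → (1/2)^r, where A_n is the number of boxes on the second main diagonal of a random α/β-staircase tableau of size n that contain α, and the expectation is taken with respect to ℙ_{n,α,β}. -/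
open scoped BigOperators

namespace StairSymb

open Finset Filter Topology

/-- The column whose only nonempty box is an `α` in row `m`. -/
def alphaCol (m : ℕ) : ℕ → StairSymb := Function.update (fun _ => empty) m alpha

/-- `c` is a column supported in the rows of `F` with nothing above an `α`. -/
def IsCol (F : Finset ℕ) (c : ℕ → StairSymb) : Prop :=
  (∀ i, i ∉ F → c i = empty) ∧ ∀ i i', i < i' → c i' = alpha → c i = empty

theorem alphaCol_self (m : ℕ) : alphaCol m m = alpha := by simp [alphaCol]

theorem alphaCol_of_ne {m i : ℕ} (h : i ≠ m) : alphaCol m i = empty := by simp [alphaCol, h]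

theorem isCol_alphaCol {F : Finset ℕ} {m : ℕ} (h : m ∈ F) : IsCol F (alphaCol m) := by
  refine ⟨fun i hi => alphaCol_of_ne (by rintro rfl; exact hi h), fun i i' hii' h' => ?_⟩
  by_cases e : i' = m
  · exact alphaCol_of_ne (by omega)
  · rw [alphaCol_of_ne e] at h'; cases h'

theorem isCol_insert_iff {F : Finset ℕ} {m : ℕ} (hm : ∀ x ∈ F, x < m) (c : ℕ → StairSymb) :
    IsCol (insert m F) c ↔ (IsCol F c ∨ ∃ d, IsCol F d ∧ Function.update d m beta = c) ∨
      c = alphaCol m := by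
  have hmF : m ∉ F := fun h => (hm m h).false
  constructor
  · rintro ⟨h1, h2⟩
    rcases hc : c m with _ | _ | _
    · refine Or.inl (Or.inl ⟨fun i hi => ?_, h2⟩)
      by_cases e : i = m
      · rw [e, hc]
      · exact h1 i (by simp [e, hi])
    · refine Or.inr (funext fun i => ?_)
      by_cases e : i = m
      · rw [e, hc, alphaCol_self]
      · rw [alphaCol_of_ne e]
        by_cases hi : i ∈ F
        · exact h2 i m (hm i hi) hc
        · exact h1 i (by simp [e, hi])
    · refine Or.inl (Or.inr ⟨Function.update c m empty, ⟨fun i hi => ?_, fun i i' hii' h => ?_⟩, ?_⟩)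
      · by_cases e : i = m
        · simp [e]
        · simpa [e] using h1 i (by simp [e, hi])
      · by_cases e' : i' = m
        · simp [e'] at h
        · by_cases e : i = m
          · simp [e]
          · simp only [Function.update_of_ne e'] at h
            simpa [e] using h2 i i' hii' h
      · simp [← hc]
  · rintro ((⟨h1, h2⟩ | ⟨d, ⟨h1, h2⟩, rfl⟩) | rfl)
    · exact ⟨fun i hi => h1 i (by simp_all), h2⟩
    · refine ⟨fun i hi => ?_, fun i i' hii' h => ?_⟩
      · have : i ≠ m ∧ i ∉ F := by simpa using hi
        simpa [this.1] using h1 i this.2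
      · by_cases e' : i' = m
        · simp [e'] at h
        · simp only [Function.update_of_ne e'] at h
          by_cases hi' : i' ∈ F
          · have := hm i' hi'
            rw [Function.update_of_ne (by omega)]
            exact h2 i i' hii' h
          · rw [h1 i' hi'] at h; cases h
    · exact isCol_alphaCol (by simp)

theorem finite_isCol (F : Finset ℕ) : {c | IsCol F c}.Finite := by
  induction F using Finset.induction_on_max with
  | empty =>
    refine (Set.finite_singleton (fun _ => empty)).subset fun c hc => ?_
    exact funext fun i => hc.1 i (by simp)
  | insert m F hm ih =>
    have : {c | IsCol (insert m F) c} =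
        ({c | IsCol F c} ∪ (fun d => Function.update d m beta) '' {c | IsCol F c}) ∪
          {alphaCol m} := by
      ext c
      simp [isCol_insert_iff hm c, or_comm]
    rw [this]
    exact (ih.union (ih.image _)).union (Set.finite_singleton _)

/-- The finite set of columns supported in `F`. -/
noncomputable def cols (F : Finset ℕ) : Finset (ℕ → StairSymb) := (finite_isCol F).toFinset

theorem mem_cols {F : Finset ℕ} {c : ℕ → StairSymb} : c ∈ cols F ↔ IsCol F c := by simp [cols]

theorem update_injOn {F : Finset ℕ} {m : ℕ} (hm : m ∉ F) (x : StairSymb) :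
    Set.InjOn (fun d : ℕ → StairSymb => Function.update d m x) (cols F) := by
  intro c hc d hd h
  funext i
  by_cases e : i = m
  · rw [e, (mem_cols.1 hc).1 m hm, (mem_cols.1 hd).1 m hm]
  · simpa [e] using congrFun h i

theorem sum_cols_insert {F : Finset ℕ} {m : ℕ} (hm : ∀ x ∈ F, x < m)
    (g : (ℕ → StairSymb) → ℝ) :
    ∑ c ∈ cols (insert m F), g c =
      ∑ c ∈ cols F, g c + ∑ c ∈ cols F, g (Function.update c m beta) + g (alphaCol m) := by
  classical
  have hmF : m ∉ F := fun h => (hm m h).false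
  have : cols (insert m F) =
      (cols F ∪ (cols F).image (fun d => Function.update d m beta)) ∪ {alphaCol m} := by
    ext c
    simp [mem_cols, isCol_insert_iff hm c, or_comm]
  rw [this, sum_union, sum_union, sum_image (update_injOn hmF _), sum_singleton]
  · rw [disjoint_left]
    rintro c hc hc'
    obtain ⟨d, -, rfl⟩ := mem_image.1 hc'
    have := (mem_cols.1 hc).1 m hmF
    simp at this
  · rw [disjoint_singleton_right, mem_union, mem_image]
    rintro (h | ⟨d, -, h⟩)
    · have := (mem_cols.1 h).1 m hmF
      rw [alphaCol_self] at this; cases this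
    · have := congrFun h m
      simp [alphaCol_self] at this

/-- The number of boxes of the column `c` containing `x`. -/
noncomputable def colCount (x : StairSymb) (c : ℕ → StairSymb) : ℕ := Set.ncard {i | c i = x}

theorem IsCol.finite {F : Finset ℕ} {c : ℕ → StairSymb} (h : IsCol F c) {x : StairSymb}
    (hx : x ≠ empty) : {i | c i = x}.Finite :=
  F.finite_toSet.subset fun i (hi : c i = x) => by
    by_contra hiF
    exact hx (hi ▸ h.1 i hiF)

theorem colCount_alphaCol_alpha (m : ℕ) : colCount alpha (alphaCol m) = 1 := by
  rw [colCount, Set.ncard_eq_one]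
  refine ⟨m, Set.ext fun i => ?_⟩
  by_cases e : i = m
  · simp [e, alphaCol_self]
  · simp [e, alphaCol_of_ne]

theorem colCount_alphaCol_beta (m : ℕ) : colCount beta (alphaCol m) = 0 := by
  rw [colCount]
  convert Set.ncard_empty ℕ
  ext i
  by_cases e : i = m
  · simp [e, alphaCol_self]
  · simp [e, alphaCol_of_ne]

theorem colCount_update_alpha {F : Finset ℕ} {c : ℕ → StairSymb} (h : IsCol F c) {m : ℕ}
    (hm : m ∉ F) : colCount alpha (Function.update c m beta) = colCount alpha c := by
  rw [colCount, colCount]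
  congr 1
  ext i
  by_cases e : i = m
  · simp [e, h.1 m hm]
  · simp [e]

theorem colCount_update_beta {F : Finset ℕ} {c : ℕ → StairSymb} (h : IsCol F c) {m : ℕ}
    (hm : m ∉ F) : colCount beta (Function.update c m beta) = colCount beta c + 1 := by
  rw [colCount, colCount, ← Set.ncard_insert_of_notMem (a := m) _ (h.finite (by simp))]
  · congr 1
    ext i
    by_cases e : i = m
    · simp [e]
    · simp [e]
  · simp [h.1 m hm]

/-- The weight of a column, with an extra factor `u` for every row of `F` without a `β`. -/
noncomputable def colWt (α β u : ℝ) (F : Finset ℕ) (c : ℕ → StairSymb) : ℝ :=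
  α ^ colCount alpha c * β ^ colCount beta c * u ^ (F.filter (fun i => c i ≠ beta)).card

theorem filter_alphaCol (F : Finset ℕ) (m : ℕ) :
    F.filter (fun i => alphaCol m i ≠ beta) = F := by
  refine filter_true_of_mem fun i _ => ?_
  by_cases e : i = m
  · simp [e, alphaCol_self]
  · simp [e, alphaCol_of_ne]

theorem colWt_alphaCol (α β u : ℝ) (F : Finset ℕ) (m : ℕ) :
    colWt α β u F (alphaCol m) = α * u ^ F.card := by
  simp [colWt, colCount_alphaCol_alpha, colCount_alphaCol_beta, filter_alphaCol]

theorem filter_update_beta (F : Finset ℕ) (c : ℕ → StairSymb) {m : ℕ} (hm : m ∉ F) :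
    F.filter (fun i => Function.update c m beta i ≠ beta) = F.filter (fun i => c i ≠ beta) := by
  refine filter_congr fun i hi => ?_
  rw [Function.update_of_ne (by rintro rfl; exact hm hi)]

theorem sum_colWt (α β u : ℝ) (F : Finset ℕ) :
    β * ∑ c ∈ cols F, colWt α β u F c =
      (α * u + β) * (u + β) ^ F.card - α * u * u ^ F.card := by
  induction F using Finset.induction_on_max with
  | empty =>
    have : cols ∅ = {fun _ => empty} := by
      ext c
      rw [mem_cols, mem_singleton]
      constructor
      · exact fun h => funext fun i => h.1 i (by simp)
      · rintro rfl
        exact ⟨fun _ _ => rfl, fun _ _ _ _ => rfl⟩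
    simp [this, colWt, colCount]
  | insert m F hm ih =>
    have hmF : m ∉ F := fun h => (hm m h).false
    have e1 : ∀ c ∈ cols F, colWt α β u (insert m F) c = u * colWt α β u F c := by
      intro c hc
      have : c m = empty := (mem_cols.1 hc).1 m hmF
      rw [colWt, colWt, filter_insert, if_pos (by simp [this]),
        card_insert_of_notMem (by simp [hmF])]
      ring
    have e2 : ∀ c ∈ cols F, colWt α β u (insert m F) (Function.update c m beta) =
        β * colWt α β u F c := by
      intro c hc
      rw [colWt, colWt, filter_insert, if_neg (by simp), filter_update_beta F c hmF,
        colCount_update_alpha (mem_cols.1 hc) hmF, colCount_update_beta (mem_cols.1 hc) hmF]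
      ring
    rw [sum_cols_insert hm, sum_congr rfl e1, sum_congr rfl e2, ← mul_sum, ← mul_sum,
      colWt_alphaCol, card_insert_of_notMem hmF]
    linear_combination (u + β) * ih

theorem sum_colWt_indicator (α β u : ℝ) {F : Finset ℕ} {n : ℕ} (hn : ∀ x ∈ F, x ≤ n) :
    ∑ c ∈ cols F, colWt α β u F c * (if c n = alpha then 1 else 0) =
      if n ∈ F then α * u ^ F.card else 0 := by
  have key : ∀ c ∈ cols F, c n = alpha → c = alphaCol n := by
    intro c hc h
    funext i
    by_cases e : i = n
    · rw [e, h, alphaCol_self]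
    · rw [alphaCol_of_ne e]
      by_cases hi : i ∈ F
      · exact (mem_cols.1 hc).2 i n (lt_of_le_of_ne (hn i hi) e) h
      · exact (mem_cols.1 hc).1 i hi
  split_ifs with h
  · rw [sum_eq_single (alphaCol n)]
    · simp [colWt_alphaCol, alphaCol_self]
    · intro c hc hne
      rw [if_neg fun h' => hne (key c hc h'), mul_zero]
    · intro h'
      exact (h' (mem_cols.2 (isCol_alphaCol h))).elim
  · refine sum_eq_zero fun c hc => ?_
    rw [if_neg, mul_zero]
    rw [(mem_cols.1 hc).1 n h]; simp

/-- Adjoin the column `c` to the left of `T`. -/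
def consCol (c : ℕ → StairSymb) (T : ℕ → ℕ → StairSymb) : ℕ → ℕ → StairSymb
  | i, 0 => T i 0
  | i, 1 => c i
  | i, j + 2 => T i (j + 1)

theorem consCol_inj {c d : ℕ → StairSymb} {T U : ℕ → ℕ → StairSymb}
    (h : consCol c T = consCol d U) : c = d ∧ T = U := by
  refine ⟨funext fun i => congrFun (congrFun h i) 1, funext fun i => funext fun j => ?_⟩
  cases j with
  | zero => exact congrFun (congrFun h i) 0
  | succ j => exact congrFun (congrFun h i) (j + 2)

theorem exists_eq_consCol (S : ℕ → ℕ → StairSymb) : ∃ c T, S = consCol c T := by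
  refine ⟨fun i => S i 1, fun i j => if j = 0 then S i 0 else S i (j + 1), ?_⟩
  funext i j
  match j with
  | 0 => simp [consCol]
  | 1 => simp [consCol]
  | j + 2 => simp [consCol]

/-- The rows of `T` (a tableau of size `n`) without a `β`. -/
noncomputable def freeRows (n : ℕ) (T : ℕ → ℕ → StairSymb) : Finset ℕ :=
  open Classical in (Icc 1 n).filter (fun i => ∀ j, T i j ≠ beta)

theorem mem_freeRows {n : ℕ} {T : ℕ → ℕ → StairSymb} {i : ℕ} :
    i ∈ freeRows n T ↔ (1 ≤ i ∧ i ≤ n) ∧ ∀ j, T i j ≠ beta := by simp [freeRows]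

/-- Tableaux of size `n + 1` arise from those of size `n` by adjoining a first column whose bottom
box is `α`, or is `β` below a column supported in the rows without a `β`. -/
theorem isStaircase_consCol_iff (n : ℕ) (c : ℕ → StairSymb) (T : ℕ → ℕ → StairSymb) :
    IsStaircase (n + 1) (consCol c T) ↔ IsStaircase n T ∧ (c = alphaCol (n + 1) ∨
      ∃ d, IsCol (freeRows n T) d ∧ Function.update d (n + 1) beta = c) := by
  constructor
  · rintro ⟨h1, h2, h3, h4⟩
    have hT : IsStaircase n T := by
      refine ⟨fun i j h => ?_, fun i i' j hi hii' hj hs h => ?_,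
        fun i j j' hi hj hjj' hs h => ?_, fun i j hi hj hs => ?_⟩
      · cases j with
        | zero => exact h1 i 0 (by omega)
        | succ j => exact h1 i (j + 2) (by omega)
      · obtain ⟨j, rfl⟩ : ∃ k, j = k + 1 := ⟨j - 1, by omega⟩
        exact h2 i i' (j + 2) hi hii' (by omega) (by omega) h
      · obtain ⟨j, rfl⟩ : ∃ k, j = k + 1 := ⟨j - 1, by omega⟩
        obtain ⟨j', rfl⟩ : ∃ k, j' = k + 1 := ⟨j' - 1, by omega⟩
        exact h3 i (j + 2) (j' + 2) hi (by omega) (by omega) (by omega) h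
      · obtain ⟨j, rfl⟩ : ∃ k, j = k + 1 := ⟨j - 1, by omega⟩
        exact h4 i (j + 2) hi (by omega) (by omega)
    refine ⟨hT, ?_⟩
    have hc0 : ∀ i, ¬ (1 ≤ i ∧ i ≤ n + 1) → c i = empty := fun i hi => h1 i 1 (by omega)
    have hcol : ∀ i i', i < i' → c i' = alpha → c i = empty := by
      intro i i' hii' h
      by_cases hi : 1 ≤ i ∧ i' ≤ n + 1
      · exact h2 i i' 1 hi.1 hii' le_rfl (by omega) h
      · by_cases hi0 : i = 0
        · exact hc0 i (by omega)
        · rw [hc0 i' (by omega)] at h; cases h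
    have hfree : ∀ i, i ∉ freeRows n T → i ≠ n + 1 → c i = empty := by
      intro i hi hne
      by_cases hin : 1 ≤ i ∧ i ≤ n + 1
      · have : ∃ j, T i j = beta := by
          by_contra hcon
          push Not at hcon
          exact hi (mem_freeRows.2 ⟨⟨hin.1, by omega⟩, hcon⟩)
        obtain ⟨j, hj⟩ := this
        have hb : 1 ≤ i ∧ 1 ≤ j ∧ i + j ≤ n + 1 := by
          by_contra hcon
          rw [hT.1 i j hcon] at hj; cases hj
        obtain ⟨j, rfl⟩ : ∃ k, j = k + 1 := ⟨j - 1, by omega⟩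
        exact h3 i 1 (j + 2) hb.1 le_rfl (by omega) (by omega) hj
      · exact hc0 i hin
    rcases hc : c (n + 1) with _ | _ | _
    · exact (h4 (n + 1) 1 (by omega) le_rfl (by omega) hc).elim
    · left
      funext i
      by_cases e : i = n + 1
      · rw [e, hc, alphaCol_self]
      · rw [alphaCol_of_ne e]
        by_cases hi : i < n + 1
        · exact hcol i _ hi hc
        · exact hc0 i (by omega)
    · right
      refine ⟨Function.update c (n + 1) empty, ⟨fun i hi => ?_, fun i i' hii' h => ?_⟩, ?_⟩
      · by_cases e : i = n + 1
        · simp [e]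
        · simpa [e] using hfree i hi e
      · by_cases e' : i' = n + 1
        · simp [e'] at h
        · by_cases e : i = n + 1
          · simp [e]
          · simp only [Function.update_of_ne e'] at h
            simpa [e] using hcol i i' hii' h
      · simp [← hc]
  · rintro ⟨⟨h1, h2, h3, h4⟩, hc⟩
    have hcc : IsCol (insert (n + 1) (freeRows n T)) c := by
      refine (isCol_insert_iff (fun x hx => ?_) c).2 ?_
      · have := mem_freeRows.1 hx; omega
      · rcases hc with hc | hc
        · exact Or.inr hc
        · exact Or.inl (Or.inr hc)
    have hne : c (n + 1) ≠ empty := by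
      rcases hc with rfl | ⟨d, -, rfl⟩
      · simp [alphaCol_self]
      · simp
    refine ⟨fun i j h => ?_, fun i i' j hi hii' hj hs h => ?_,
        fun i j j' hi hj hjj' hs h => ?_, fun i j hi hj hs => ?_⟩
    · match j with
      | 0 => exact h1 i 0 (by omega)
      | 1 =>
        refine hcc.1 i fun hi => ?_
        rcases mem_insert.1 hi with rfl | hi
        · omega
        · have := mem_freeRows.1 hi; omega
      | j + 2 => exact h1 i (j + 1) (by omega)
    · match j with
      | 0 => omega
      | 1 => exact hcc.2 i i' hii' h
      | j + 2 => exact h2 i i' (j + 1) hi hii' (by omega) (by omega) h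
    · match j, j' with
      | 0, _ => omega
      | _, 0 => omega
      | _, 1 => omega
      | 1, j' + 2 =>
        refine hcc.1 i fun hi => ?_
        rcases mem_insert.1 hi with rfl | hi
        · omega
        · exact (mem_freeRows.1 hi).2 _ h
      | j + 2, j' + 2 => exact h3 i (j + 1) (j' + 1) hi (by omega) (by omega) (by omega) h
    · match j with
      | 0 => omega
      | 1 =>
        obtain rfl : i = n + 1 := by omega
        exact hne
      | j + 2 => exact h4 i (j + 1) hi (by omega) (by omega)

/-- The finite set of tableaux of size `n`, built column by column. -/
noncomputable def stairs : ℕ → Finset (ℕ → ℕ → StairSymb)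
  | 0 => {fun _ _ => empty}
  | n + 1 => open Classical in (stairs n).biUnion fun T =>
      insert (consCol (alphaCol (n + 1)) T)
        ((cols (freeRows n T)).image fun c => consCol (Function.update c (n + 1) beta) T)

theorem mem_stairs {n : ℕ} {S : ℕ → ℕ → StairSymb} : S ∈ stairs n ↔ IsStaircase n S := by
  induction n generalizing S with
  | zero =>
    rw [stairs, mem_singleton]
    constructor
    · rintro rfl
      exact ⟨fun _ _ _ => rfl, fun _ _ _ _ _ _ _ _ => rfl, fun _ _ _ _ _ _ _ _ => rfl,
        fun i j _ _ _ => by omega⟩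
    · exact fun h => funext fun i => funext fun j => h.1 i j (by omega)
  | succ n ih =>
    classical
    obtain ⟨c, T, rfl⟩ := exists_eq_consCol S
    rw [isStaircase_consCol_iff, stairs]
    simp only [mem_biUnion, mem_insert, mem_image, ih, mem_cols]
    constructor
    · rintro ⟨U, hU, h | ⟨d, hd, h⟩⟩
      · obtain ⟨rfl, rfl⟩ := consCol_inj h
        exact ⟨hU, Or.inl rfl⟩
      · obtain ⟨rfl, rfl⟩ := consCol_inj h
        exact ⟨hU, Or.inr ⟨d, hd, rfl⟩⟩
    · rintro ⟨hT, rfl | ⟨d, hd, rfl⟩⟩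
      · exact ⟨T, hT, Or.inl rfl⟩
      · exact ⟨T, hT, Or.inr ⟨d, hd, rfl⟩⟩

theorem notMem_freeRows_succ (n : ℕ) (T : ℕ → ℕ → StairSymb) : n + 1 ∉ freeRows n T := by
  intro h
  have := mem_freeRows.1 h
  omega

theorem sum_stairs_succ (n : ℕ) (g : (ℕ → ℕ → StairSymb) → ℝ) :
    ∑ S ∈ stairs (n + 1), g S = ∑ T ∈ stairs n, (g (consCol (alphaCol (n + 1)) T) +
      ∑ c ∈ cols (freeRows n T), g (consCol (Function.update c (n + 1) beta) T)) := by
  classical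
  rw [stairs, sum_biUnion]
  · refine sum_congr rfl fun T _ => ?_
    rw [sum_insert, sum_image]
    · intro c hc d hd h
      exact update_injOn (notMem_freeRows_succ n T) _ hc hd (consCol_inj h).1
    · intro h
      obtain ⟨d, -, h⟩ := mem_image.1 h
      have := congrFun (consCol_inj h).1 (n + 1)
      simp [alphaCol_self] at this
  · have key : ∀ V S, S ∈ insert (consCol (alphaCol (n + 1)) V)
        ((cols (freeRows n V)).image fun c => consCol (Function.update c (n + 1) beta) V) →
        ∃ c, S = consCol c V := by
      intro V S hS
      rcases mem_insert.1 hS with rfl | hS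
      · exact ⟨_, rfl⟩
      · obtain ⟨d, -, rfl⟩ := mem_image.1 hS
        exact ⟨_, rfl⟩
    intro T _ U _ hTU
    rw [Function.onFun, disjoint_left]
    intro S hS hS'
    obtain ⟨c, rfl⟩ := key T S hS
    obtain ⟨d, h⟩ := key U _ hS'
    exact hTU (consCol_inj h).2

theorem finite_boxes {n : ℕ} {T : ℕ → ℕ → StairSymb} (hT : IsStaircase n T) {x : StairSymb}
    (hx : x ≠ empty) : {p : ℕ × ℕ | T p.1 p.2 = x}.Finite := by
  refine ((Icc 1 (n + 1) ×ˢ Icc 1 (n + 1)).finite_toSet).subset fun p (hp : T p.1 p.2 = x) => ?_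
  have : 1 ≤ p.1 ∧ 1 ≤ p.2 ∧ p.1 + p.2 ≤ n + 1 := by
    by_contra h
    exact hx (hp ▸ hT.1 _ _ h)
  simp only [coe_product, Set.mem_prod, coe_Icc, Set.mem_Icc]
  omega

theorem ncard_consCol {n : ℕ} {T : ℕ → ℕ → StairSymb} (hT : IsStaircase n T) {F : Finset ℕ}
    {c : ℕ → StairSymb} (hc : IsCol F c) {x : StairSymb} (hx : x ≠ empty) :
    Set.ncard {p : ℕ × ℕ | consCol c T p.1 p.2 = x} =
      colCount x c + Set.ncard {p : ℕ × ℕ | T p.1 p.2 = x} := by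
  have : {p : ℕ × ℕ | consCol c T p.1 p.2 = x} =
      (fun i => (i, 1)) '' {i | c i = x} ∪
        (fun p : ℕ × ℕ => (p.1, p.2 + 1)) '' {p : ℕ × ℕ | T p.1 p.2 = x} := by
    have h0 : ∀ i, T i 0 ≠ x := fun i => by rw [hT.1 i 0 (by omega)]; exact hx.symm
    ext ⟨i, j⟩
    match j with
    | 0 => simp [consCol, h0]
    | 1 => simp [consCol, h0]
    | j + 2 => simp [consCol]
  rw [this, Set.ncard_union_eq _ ((hc.finite hx).image _) ((finite_boxes hT hx).image _),
    Set.ncard_image_of_injective, Set.ncard_image_of_injective, colCount]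
  · rintro ⟨i, j⟩ ⟨k, l⟩ h
    simpa using h
  · intro i k h
    simpa using h
  · rw [Set.disjoint_left]
    rintro _ ⟨i, -, rfl⟩ ⟨⟨k, l⟩, h, h'⟩
    have h0 : T k 0 ≠ x := by rw [hT.1 k 0 (by omega)]; exact hx.symm
    have : k = i ∧ l = 0 := by simpa using h'
    exact h0 (this.2 ▸ h)

theorem stairWt_consCol (α β : ℝ) {n : ℕ} {T : ℕ → ℕ → StairSymb} (hT : IsStaircase n T)
    {F : Finset ℕ} {c : ℕ → StairSymb} (hc : IsCol F c) :
    stairWt α β (consCol c T) =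
      α ^ colCount alpha c * β ^ colCount beta c * stairWt α β T := by
  rw [stairWt, stairWt, ncard_consCol hT hc (by simp), ncard_consCol hT hc (by simp)]
  ring

/-- The number of `α`'s on the second main diagonal of a tableau of size `n`. -/
def secondDiag (n : ℕ) (S : ℕ → ℕ → StairSymb) : ℕ :=
  ((Icc 1 (n - 1)).filter (fun j => S (n - j) j = alpha)).card

theorem secondDiag_consCol (n : ℕ) (c : ℕ → StairSymb) (T : ℕ → ℕ → StairSymb)
    (hc : c 0 = empty) :
    secondDiag (n + 1) (consCol c T) = secondDiag n T + if c n = alpha then 1 else 0 := by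
  cases n with
  | zero => simp [secondDiag, hc]
  | succ n =>
    simp only [secondDiag, card_filter]
    have h : Icc 1 (n + 1 + 1 - 1) = Ico 1 (n + 2) := by ext; simp; omega
    have h' : Icc 1 (n + 1 - 1) = Ico 1 (n + 1) := by ext; simp
    rw [h, h', sum_eq_sum_Ico_succ_bot (by omega), add_comm]
    congr 1
    rw [sum_Ico_eq_sum_range, sum_Ico_eq_sum_range]
    refine sum_congr (by congr 1) fun k _ => ?_
    rw [show 1 + 1 + k = k + 2 by omega, show 1 + k = k + 1 by omega,
      show n + 1 + 1 - (k + 2) = n + 1 - (k + 1) by omega]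
    rfl

theorem freeRows_consCol_alphaCol {n : ℕ} {T : ℕ → ℕ → StairSymb} (hT : IsStaircase n T) :
    freeRows (n + 1) (consCol (alphaCol (n + 1)) T) = insert (n + 1) (freeRows n T) := by
  ext i
  rw [mem_insert, mem_freeRows, mem_freeRows]
  constructor
  · rintro ⟨hi, h⟩
    by_cases e : i = n + 1
    · exact Or.inl e
    · refine Or.inr ⟨by omega, fun j => ?_⟩
      cases j with
      | zero => exact h 0
      | succ j => exact h (j + 2)
  · rintro (rfl | ⟨hi, h⟩)
    · refine ⟨by omega, fun j => ?_⟩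
      match j with
      | 0 => simp [consCol, hT.1 (n + 1) 0]
      | 1 => simp [consCol, alphaCol_self]
      | j + 2 => rw [consCol, hT.1 (n + 1) (j + 1) (by omega)]; simp
    · refine ⟨by omega, fun j => ?_⟩
      match j with
      | 0 => exact h 0
      | 1 => rw [consCol, alphaCol_of_ne (by omega)]; simp
      | j + 2 => exact h (j + 1)

theorem freeRows_consCol_update {n : ℕ} {T : ℕ → ℕ → StairSymb} (c : ℕ → StairSymb) :
    freeRows (n + 1) (consCol (Function.update c (n + 1) beta) T) =
      (freeRows n T).filter (fun i => c i ≠ beta) := by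
  ext i
  rw [mem_filter, mem_freeRows, mem_freeRows]
  constructor
  · rintro ⟨hi, h⟩
    have h1 := h 1
    have e : i ≠ n + 1 := by rintro rfl; simp [consCol] at h1
    simp only [consCol, Function.update_of_ne e] at h1
    refine ⟨⟨by omega, fun j => ?_⟩, h1⟩
    cases j with
    | zero => exact h 0
    | succ j => exact h (j + 2)
  · rintro ⟨⟨hi, h⟩, h1⟩
    refine ⟨by omega, fun j => ?_⟩
    match j with
    | 0 => exact h 0
    | 1 => rw [consCol, Function.update_of_ne (by omega)]; exact h1
    | j + 2 => exact h (j + 1)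

theorem isCol_update_succ {n : ℕ} {T : ℕ → ℕ → StairSymb} {c : ℕ → StairSymb}
    (hc : IsCol (freeRows n T) c) :
    IsCol (insert (n + 1) (freeRows n T)) (Function.update c (n + 1) beta) := by
  refine (isCol_insert_iff (fun x hx => ?_) _).2 (Or.inl (Or.inr ⟨c, hc, rfl⟩))
  have := mem_freeRows.1 hx
  omega

/-- The total of `stairWt · u ^ freeRows · (secondDiag)_r` over the tableaux of size `n`. -/
noncomputable def momentSum (α β : ℝ) (r n : ℕ) (u : ℝ) : ℝ :=
  ∑ S ∈ stairs n, stairWt α β S * u ^ (freeRows n S).card * ((secondDiag n S).descFactorial r : ℝ)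

theorem descFactorial_succ_add (A r : ℕ) :
    (A + 1).descFactorial (r + 1) = A.descFactorial (r + 1) + (r + 1) * A.descFactorial r := by
  rw [Nat.succ_descFactorial_succ, Nat.descFactorial_succ, ← add_mul]
  rcases le_or_gt r A with h | h
  · congr 1; omega
  · simp [Nat.descFactorial_of_lt h]

theorem descFactorial_add_indicator (A r : ℕ) (p : Prop) [Decidable p] :
    (((A + if p then 1 else 0).descFactorial r : ℕ) : ℝ) =
      A.descFactorial r + (if p then 1 else 0) * (r * A.descFactorial (r - 1)) := by
  split_ifs
  · cases r with
    | zero => simp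
    | succ r => rw [descFactorial_succ_add]; push_cast; simp
  · simp

theorem summand_alphaCol (α β u : ℝ) (r : ℕ) {n : ℕ} {T : ℕ → ℕ → StairSymb}
    (hT : T ∈ stairs n) :
    stairWt α β (consCol (alphaCol (n + 1)) T) *
        u ^ (freeRows (n + 1) (consCol (alphaCol (n + 1)) T)).card *
        ((secondDiag (n + 1) (consCol (alphaCol (n + 1)) T)).descFactorial r : ℝ) =
      α * u * (stairWt α β T * u ^ (freeRows n T).card * ((secondDiag n T).descFactorial r : ℝ)) := by
  have hT := mem_stairs.1 hT
  rw [stairWt_consCol α β hT (isCol_alphaCol (mem_singleton_self (n + 1))),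
    freeRows_consCol_alphaCol hT, card_insert_of_notMem (notMem_freeRows_succ n T),
    secondDiag_consCol _ _ _ (alphaCol_of_ne (by omega)), alphaCol_of_ne (by omega),
    colCount_alphaCol_alpha, colCount_alphaCol_beta]
  simp
  ring

theorem momentSum_succ (α β : ℝ) (r n : ℕ) (u : ℝ) :
    momentSum α β r (n + 1) u = (α * u + β) * momentSum α β r n (u + β) +
      r * α * β * ∑ T ∈ stairs n, if n ∈ freeRows n T then
        stairWt α β T * u ^ (freeRows n T).card *
          ((secondDiag n T).descFactorial (r - 1) : ℝ) else 0 := by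
  rw [momentSum, momentSum, sum_stairs_succ, mul_sum, mul_sum, ← sum_add_distrib]
  refine sum_congr rfl fun T hT => ?_
  rw [summand_alphaCol α β u r hT]
  have hF : ∀ x ∈ freeRows n T, x ≤ n := fun x hx => (mem_freeRows.1 hx).1.2
  have key : ∀ c ∈ cols (freeRows n T),
      stairWt α β (consCol (Function.update c (n + 1) beta) T) *
        u ^ (freeRows (n + 1) (consCol (Function.update c (n + 1) beta) T)).card *
        ((secondDiag (n + 1) (consCol (Function.update c (n + 1) beta) T)).descFactorial r : ℝ) =
      β * stairWt α β T * (secondDiag n T).descFactorial r * colWt α β u (freeRows n T) c +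
      β * stairWt α β T * (r * (secondDiag n T).descFactorial (r - 1)) *
        (colWt α β u (freeRows n T) c * (if c n = alpha then 1 else 0)) := by
    intro c hc
    have hc := mem_cols.1 hc
    have hn := notMem_freeRows_succ n T
    rw [stairWt_consCol α β (mem_stairs.1 hT) (isCol_update_succ hc), freeRows_consCol_update,
      secondDiag_consCol, Function.update_of_ne (by omega), descFactorial_add_indicator,
      colCount_update_alpha hc hn, colCount_update_beta hc hn, colWt]
    · ring
    · rw [Function.update_of_ne (by omega)]
      exact hc.1 0 fun h => by have := mem_freeRows.1 h; omega
  rw [sum_congr rfl key, sum_add_distrib, ← mul_sum, ← mul_sum, sum_colWt_indicator α β u hF]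
  have := sum_colWt α β u (freeRows n T)
  split_ifs
  · linear_combination (stairWt α β T * (secondDiag n T).descFactorial r) * this
  · linear_combination (stairWt α β T * (secondDiag n T).descFactorial r) * this

theorem momentSum_zero (α β : ℝ) (r : ℕ) (u : ℝ) :
    momentSum α β r 0 u = if r = 0 then 1 else 0 := by
  cases r <;> simp [momentSum, stairs, stairWt, freeRows, secondDiag]

theorem momentSum_one (α β : ℝ) (r : ℕ) (u : ℝ) :
    momentSum α β r 1 u = (α * u + β) * momentSum α β r 0 (u + β) := by
  rw [momentSum_succ]
  simp [freeRows]

theorem momentSum_add_two (α β : ℝ) (r n : ℕ) (u : ℝ) :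
    momentSum α β r (n + 2) u = (α * u + β) * momentSum α β r (n + 1) (u + β) +
      r * α * β * (α * u * momentSum α β (r - 1) n u) := by
  rw [momentSum_succ]
  congr 2
  rw [sum_stairs_succ, momentSum, mul_sum]
  refine sum_congr rfl fun T hT => ?_
  rw [if_pos, summand_alphaCol α β u _ hT, sum_eq_zero, add_zero]
  · intro c _
    rw [if_neg]
    intro h
    exact (mem_freeRows.1 h).2 1 (by simp [consCol])
  · rw [freeRows_consCol_alphaCol (mem_stairs.1 hT)]
    simp

theorem stairE_eq (n : ℕ) (α β : ℝ) (r : ℕ) :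
    stairE n α β (fun S => ((secondDiag n S).descFactorial r : ℝ)) =
      momentSum α β r n 1 / momentSum α β 0 n 1 := by
  have h : {S | IsStaircase n S} = (stairs n : Set (ℕ → ℕ → StairSymb)) := by
    ext S; simp [mem_stairs]
  rw [stairE, stairZ, h, finsum_mem_coe_finset, finsum_mem_coe_finset, momentSum, momentSum]
  simp [mul_comm]

/-- The factorial moment sums after division by the total weight and rescaling. -/
noncomputable def reducedMoment : ℕ → ℕ → ℝ → ℝ
  | r, 0, _ => if r = 0 then 1 else 0
  | r, 1, _ => if r = 0 then 1 else 0
  | r, n + 2, s => reducedMoment r (n + 1) (s + 1) + r * s * reducedMoment (r - 1) n s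

theorem reducedMoment_zero (n : ℕ) (s : ℝ) : reducedMoment 0 n s = 1 := by
  induction n using Nat.strong_induction_on generalizing s with
  | _ n ih =>
    match n with
    | 0 => simp [reducedMoment]
    | 1 => simp [reducedMoment]
    | n + 2 => simp [reducedMoment, ih (n + 1) (by omega)]

theorem reducedMoment_eq_zero {r n : ℕ} (h : n < 2 * r) (s : ℝ) : reducedMoment r n s = 0 := by
  induction n using Nat.strong_induction_on generalizing r s with
  | _ n ih =>
    match n with
    | 0 => simp [reducedMoment, show r ≠ 0 by omega]
    | 1 => simp [reducedMoment, show r ≠ 0 by omega]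
    | n + 2 =>
      rw [reducedMoment, ih (n + 1) (by omega) (by omega), ih n (by omega) (by omega)]
      simp

theorem momentSum_eq_reducedMoment {α β : ℝ} (hα : α ≠ 0) (hβ : β ≠ 0) (r n : ℕ) (s : ℝ) :
    momentSum α β r n (β * s) = (α * β) ^ n * reducedMoment r n s *
      ∏ i ∈ range (n - 2 * r), (s + 1 / α + i) := by
  have shift : ∀ (k : ℕ) (s : ℝ), (s + 1 / α) * ∏ i ∈ range k, (s + 1 + 1 / α + i) =
      ∏ i ∈ range (k + 1), (s + 1 / α + i) := by
    intro k s
    rw [prod_range_succ', mul_comm]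
    congr 1
    · exact prod_congr rfl fun i _ => by push_cast; ring
    · simp
  have lin : ∀ s : ℝ, α * (β * s) + β = α * β * (s + 1 / α) := by
    intro s; field_simp
  have arg : ∀ s : ℝ, β * s + β = β * (s + 1) := by
    intro s; ring
  induction n using Nat.strong_induction_on generalizing r s with
  | _ n ih =>
    match n with
    | 0 => cases r <;> simp [momentSum_zero, reducedMoment]
    | 1 =>
      rw [momentSum_one, momentSum_zero, lin]
      cases r <;> simp [reducedMoment, show ∀ r, 1 - 2 * (r + 1) = 0 by omega]
    | n + 2 =>
      rw [momentSum_add_two, arg, ih (n + 1) (by omega), ih n (by omega), lin, reducedMoment]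
      rcases Nat.eq_zero_or_pos r with rfl | hr
      · have := shift (n + 1) s
        simp only [mul_zero, Nat.sub_zero, CharP.cast_eq_zero, zero_mul, add_zero]
        rw [← this]
        ring
      · have e : n - 2 * (r - 1) = n + 2 - 2 * r := by omega
        rw [e]
        rcases lt_or_ge (n + 1) (2 * r) with h | h
        · rw [reducedMoment_eq_zero h]
          ring
        · have := shift (n + 1 - 2 * r) s
          rw [show n + 1 - 2 * r + 1 = n + 2 - 2 * r by omega] at this
          rw [← this]
          ring

theorem pow_succ_sub_le {x y : ℝ} (hy : 0 ≤ y) (hxy : y ≤ x) (k : ℕ) :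
    x ^ (k + 1) - y ^ (k + 1) ≤ (k + 1) * (x - y) * x ^ k := by
  induction k with
  | zero => simp
  | succ k ih =>
    have h1 := mul_le_mul_of_nonneg_left ih (hy.trans hxy)
    have h2 := mul_le_mul_of_nonneg_left (pow_le_pow_left₀ hy hxy (k + 1)) (sub_nonneg.2 hxy)
    push_cast
    linear_combination h1 + h2

theorem le_pow_succ_sub {x y : ℝ} (hy : 0 ≤ y) (hxy : y ≤ x) (k : ℕ) :
    (k + 1) * (x - y) * y ^ k ≤ x ^ (k + 1) - y ^ (k + 1) := by
  induction k with
  | zero => simp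
  | succ k ih =>
    have h1 := mul_le_mul_of_nonneg_left ih hy
    have h2 := mul_le_mul_of_nonneg_left (pow_le_pow_left₀ hy hxy (k + 1)) (sub_nonneg.2 hxy)
    push_cast
    linear_combination h1 + h2

theorem reducedMoment_bounds (r n : ℕ) {s : ℝ} (hs : 0 ≤ s) :
    max (n * s + n * (n - 1) / 2 - 2 * r * (s + n)) 0 ^ r ≤ reducedMoment r n s ∧
      reducedMoment r n s ≤ (n * s + n * (n - 1) / 2) ^ r := by
  induction n using Nat.strong_induction_on generalizing r s with
  | _ n ih =>
    rcases r with _ | k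
    · simp [reducedMoment_zero]
    match n with
    | 0 =>
      rw [max_eq_right]
      · simp [reducedMoment]
      · push_cast; nlinarith
    | 1 =>
      rw [max_eq_right]
      · simp [reducedMoment]; positivity
      · push_cast
        have : 0 ≤ (k : ℝ) * (s + 1) := by positivity
        nlinarith
    | n + 2 =>
      obtain ⟨l1, u1⟩ := ih (n + 1) (by omega) (k + 1) (s := s + 1) (by linarith)
      obtain ⟨l2, u2⟩ := ih n (by omega) k hs
      rw [reducedMoment, Nat.add_sub_cancel]
      have hc : 0 ≤ ((k + 1 : ℕ) : ℝ) * s := by positivity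
      have hn : (0 : ℝ) ≤ n := n.cast_nonneg
      have hk : (0 : ℝ) ≤ k := k.cast_nonneg
      have hsq : (0 : ℝ) ≤ n * (n - 1) / 2 := by
        rcases n.eq_zero_or_pos with rfl | h
        · simp
        · have : (1 : ℝ) ≤ n := by exact_mod_cast h
          have := mul_nonneg hn (sub_nonneg.2 this)
          linarith
      have hns : 0 ≤ n * s := by positivity
      push_cast at l1 u1 hc ⊢
      constructor
      · set X : ℝ := (n + 2) * s + (n + 2) * (n + 2 - 1) / 2 - 2 * (k + 1) * (s + (n + 2)) with hX
        have e1 : (n + 1) * (s + 1) + (n + 1) * (n + 1 - 1) / 2 - 2 * (k + 1) * (s + 1 + (n + 1))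
            = X - s := by rw [hX]; ring
        rw [e1] at l1
        have hle : max X 0 ≤ max (n * s + n * (n - 1) / 2 - 2 * k * (s + n)) 0 := by
          refine max_le_max ?_ le_rfl
          rw [hX]
          nlinarith
        have l3 := mul_le_mul_of_nonneg_left
          ((pow_le_pow_left₀ (le_max_right X 0) hle k).trans l2) hc
        have l4 := pow_succ_sub_le (le_max_right (X - s) 0)
          (max_le_max (by linarith : X - s ≤ X) le_rfl) k
        have hd : max X 0 - max (X - s) 0 ≤ s := by
          have : max X 0 ≤ max (X - s) 0 + s :=
            max_le (by linarith [le_max_left (X - s) 0]) (by linarith [le_max_right (X - s) 0])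
          linarith
        have l5 : ((k : ℝ) + 1) * (max X 0 - max (X - s) 0) * max X 0 ^ k ≤
            (k + 1) * s * max X 0 ^ k := by gcongr
        linarith
      · set Y : ℝ := (n + 1) * (s + 1) + (n + 1) * (n + 1 - 1) / 2 with hY
        have e1 : (n + 2) * s + (n + 2) * (n + 2 - 1) / 2 = Y + s := by rw [hY]; ring
        rw [e1]
        have hQ : 0 ≤ n * s + n * ((n : ℝ) - 1) / 2 := by linarith
        have hle : n * s + n * ((n : ℝ) - 1) / 2 ≤ Y := by
          rw [hY]
          nlinarith
        have l3 := mul_le_mul_of_nonneg_left (u2.trans (pow_le_pow_left₀ hQ hle k)) hc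
        have l4 := le_pow_succ_sub (hQ.trans hle) (by linarith : Y ≤ Y + s) k
        rw [add_sub_cancel_left] at l4
        linarith

theorem tendsto_quadratic_div_sq (x y : ℝ) :
    Tendsto (fun m : ℕ => ((m : ℝ) ^ 2 / 2 + x * m + y) / (m : ℝ) ^ 2) atTop (𝓝 (1 / 2)) := by
  have h : Tendsto (fun m : ℕ => (1 / 2 : ℝ) + x / m + y / (m : ℝ) ^ 2) atTop (𝓝 (1 / 2 + 0 + 0)) := by
    refine (tendsto_const_nhds.add (tendsto_const_div_atTop_nhds_zero_nat x)).add ?_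
    exact (tendsto_const_nhds (x := y)).div_atTop
      ((tendsto_pow_atTop (by norm_num)).comp tendsto_natCast_atTop_atTop)
  rw [add_zero, add_zero] at h
  refine h.congr' ?_
  filter_upwards [eventually_gt_atTop 0] with m hm
  have : (m : ℝ) ≠ 0 := by positivity
  field_simp

theorem tendsto_reducedMoment_div (r : ℕ) {s : ℝ} (hs : 0 ≤ s) :
    Tendsto (fun m : ℕ => reducedMoment r (m + 2 * r) s / (m : ℝ) ^ (2 * r)) atTop
      (𝓝 ((1 / 2) ^ r)) := by
  have hu : Tendsto (fun m : ℕ => (((m + 2 * r : ℕ) : ℝ) * s +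
      (m + 2 * r : ℕ) * ((m + 2 * r : ℕ) - 1) / 2) / (m : ℝ) ^ 2) atTop (𝓝 (1 / 2)) := by
    convert tendsto_quadratic_div_sq (s + 2 * r - 1 / 2) (2 * r * s + r * (2 * r - 1)) using 3
    push_cast; ring
  have hl : Tendsto (fun m : ℕ => (((m + 2 * r : ℕ) : ℝ) * s +
      (m + 2 * r : ℕ) * ((m + 2 * r : ℕ) - 1) / 2 - 2 * r * (s + (m + 2 * r : ℕ))) / (m : ℝ) ^ 2)
      atTop (𝓝 (1 / 2)) := by
    convert tendsto_quadratic_div_sq (s - 1 / 2)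
      (r * (2 * r - 1) - 2 * r * (2 * r)) using 3
    push_cast; ring
  have hl' := (hl.max (tendsto_const_nhds (x := (0 : ℝ)))).pow r
  rw [max_eq_left (by norm_num)] at hl'
  refine tendsto_of_tendsto_of_tendsto_of_le_of_le hl' (hu.pow r) (fun m => ?_) (fun m => ?_)
  · have h0 : (0 : ℝ) ≤ (m : ℝ) ^ 2 := by positivity
    dsimp only
    rw [← zero_div ((m : ℝ) ^ 2), max_div_div_right h0, div_pow, ← pow_mul]
    exact div_le_div_of_nonneg_right (reducedMoment_bounds r _ hs).1 (by positivity)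
  · dsimp only
    rw [div_pow, ← pow_mul]
    exact div_le_div_of_nonneg_right (reducedMoment_bounds r _ hs).2 (by positivity)

theorem tendsto_prod_div_pow (c : ℝ) (k : ℕ) :
    Tendsto (fun m : ℕ => (∏ i ∈ range k, (c + ((m + i : ℕ) : ℝ))) / (m : ℝ) ^ k) atTop (𝓝 1) := by
  have h : Tendsto (fun m : ℕ => ∏ i ∈ range k, ((c + ((m + i : ℕ) : ℝ)) / m)) atTop
      (𝓝 (∏ _i ∈ range k, (1 : ℝ))) := by
    refine tendsto_finsetProd _ fun i _ => ?_
    have h1 : Tendsto (fun m : ℕ => (1 : ℝ) + (c + i) / m) atTop (𝓝 (1 + 0)) :=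
      tendsto_const_nhds.add (tendsto_const_div_atTop_nhds_zero_nat _)
    rw [add_zero] at h1
    refine h1.congr' ?_
    filter_upwards [eventually_gt_atTop 0] with m hm
    have : (m : ℝ) ≠ 0 := by positivity
    push_cast
    field_simp
    ring
  simpa [prod_div_distrib] using h

theorem momentSum_div_eq {α β : ℝ} (hα : 0 < α) (hβ : 0 < β) (r m : ℕ) :
    momentSum α β r (m + 2 * r) 1 / momentSum α β 0 (m + 2 * r) 1 =
      reducedMoment r (m + 2 * r) (1 / β) /
        ∏ i ∈ range (2 * r), (1 / β + 1 / α + ((m + i : ℕ) : ℝ)) := by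
  have h1 : (1 : ℝ) = β * (1 / β) := by field_simp
  have hpos : ∀ i : ℕ, 0 < 1 / β + 1 / α + (i : ℝ) := fun i => by positivity
  have hm : ∏ i ∈ range m, (1 / β + 1 / α + (i : ℝ)) ≠ 0 :=
    (prod_pos fun i _ => hpos i).ne'
  have hr : ∏ i ∈ range (2 * r), (1 / β + 1 / α + ((m + i : ℕ) : ℝ)) ≠ 0 :=
    (prod_pos fun i _ => hpos _).ne'
  have hab : (α * β) ^ (m + 2 * r) ≠ 0 := by positivity
  conv_lhs => rw [h1]
  rw [momentSum_eq_reducedMoment hα.ne' hβ.ne', momentSum_eq_reducedMoment hα.ne' hβ.ne',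
    reducedMoment_zero, mul_zero, Nat.sub_zero, Nat.add_sub_cancel, prod_range_add,
    div_eq_div_iff (by simp only [mul_one]; exact mul_ne_zero hab (mul_ne_zero hm hr)) hr]
  ring

end StairSymb

/-- The r-th factorial moment of the number `A_n` of α's on the second main diagonal
converges to `(1/2)^r`. -/
theorem factorial_moments_alphas_second_diagonal
    (α β : ℝ) (hα : 0 < α) (hβ : 0 < β) (r : ℕ) (hr : 1 ≤ r) :
    Filter.Tendsto (fun n : ℕ =>
        stairE n α β (fun S =>
          (Nat.descFactorial
            (((Finset.Icc 1 (n - 1)).filter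
              (fun j => S (n - j) j = StairSymb.alpha)).card) r : ℝ)))
      Filter.atTop (nhds ((1 / 2 : ℝ) ^ r)) := by
  refine (Filter.tendsto_add_atTop_iff_nat (2 * r)).1 ?_
  have h := (StairSymb.tendsto_reducedMoment_div r (s := 1 / β) (by positivity)).div
    (StairSymb.tendsto_prod_div_pow (1 / β + 1 / α) (2 * r)) one_ne_zero
  rw [div_one] at h
  refine h.congr' ?_
  filter_upwards [Filter.eventually_gt_atTop 0] with m hm
  have hm0 : (m : ℝ) ^ (2 * r) ≠ 0 := by positivity
  rw [Pi.div_apply, div_div_div_cancel_right₀ hm0, ← StairSymb.momentSum_div_eq hα hβ]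
  exact (StairSymb.stairE_eq _ α β r).symm
end

section
/- Fix α, β ∈ (0, ∞). Let A_n be the number of boxes on the second main diagonal of a random α/β-staircase tableau of size n that contain α. Then A_n converges in distribution to a Poisson random variable with parameter 1/2: for every integer k ≥ 0, ℙ_{n,α,β}(A_n = k) → e^{−1/2} (1/2)^k / k! as n → ∞. -/
open scoped BigOperators

namespace Staircase

open Finset Function StairSymb

open Classical in
/-- The fillings of rows `1, …, m` of a column in which every nonempty box lies in a row
satisfying `R` and every box above an `α` is empty. -/
noncomputable def fillings (R : ℕ → Prop) : ℕ → Finset (ℕ → StairSymb)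
  | 0 => {fun _ => empty}
  | m + 1 =>
    if R (m + 1) then
      fillings R m ∪ ((fillings R m).image (fun u => update u (m + 1) beta) ∪
        {update (fun _ => empty) (m + 1) alpha})
    else fillings R m

theorem mem_fillings {R : ℕ → Prop} {m : ℕ} {u : ℕ → StairSymb} :
    u ∈ fillings R m ↔ (∀ i, u i ≠ empty → 1 ≤ i ∧ i ≤ m ∧ R i) ∧
      ∀ i i', i < i' → u i' = alpha → u i = empty := by
  induction m generalizing u with
  | zero =>
    simp only [fillings, mem_singleton]
    constructor
    · rintro rfl
      simp
    · rintro ⟨h, -⟩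
      funext i
      by_contra hi
      have := h i hi
      omega
  | succ m ih =>
    by_cases hR : R (m + 1)
    · simp only [fillings, hR, if_true, mem_union, mem_image, mem_singleton]
      constructor
      · rintro (hu | ⟨w, hw, rfl⟩ | rfl)
        · obtain ⟨h1, h2⟩ := ih.1 hu
          exact ⟨fun i hi => ⟨(h1 i hi).1, (h1 i hi).2.1.trans m.le_succ, (h1 i hi).2.2⟩, h2⟩
        · obtain ⟨h1, h2⟩ := ih.1 hw
          refine ⟨fun i hi => ?_, fun i i' hii' hi' => ?_⟩
          · rcases eq_or_ne i (m + 1) with rfl | hne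
            · exact ⟨by omega, le_rfl, hR⟩
            · rw [update_of_ne hne] at hi
              exact ⟨(h1 i hi).1, (h1 i hi).2.1.trans m.le_succ, (h1 i hi).2.2⟩
          · rcases eq_or_ne i' (m + 1) with rfl | hne
            · simp at hi'
            · rw [update_of_ne hne] at hi'
              have := h1 i' (by simp [hi'])
              rw [update_of_ne (by omega)]
              exact h2 i i' hii' hi'
        · refine ⟨fun i hi => ?_, fun i i' hii' hi' => ?_⟩
          · rcases eq_or_ne i (m + 1) with rfl | hne
            · exact ⟨by omega, le_rfl, hR⟩
            · simp [update_of_ne hne] at hi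
          · rcases eq_or_ne i' (m + 1) with rfl | hne
            · rw [update_of_ne (by omega)]
            · simp [update_of_ne hne] at hi'
      · rintro ⟨h1, h2⟩
        cases hu : u (m + 1) with
        | empty =>
          refine .inl (ih.2 ⟨fun i hi => ?_, h2⟩)
          have := h1 i hi
          refine ⟨this.1, ?_, this.2.2⟩
          have : i ≠ m + 1 := by rintro rfl; exact hi hu
          omega
        | beta =>
          refine .inr (.inl ⟨update u (m + 1) empty, ih.2 ⟨fun i hi => ?_, fun i i' hii' hi' => ?_⟩,
            by simp [← hu]⟩)
          · rcases eq_or_ne i (m + 1) with rfl | hne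
            · simp at hi
            · rw [update_of_ne hne] at hi
              have := h1 i hi
              exact ⟨this.1, by omega, this.2.2⟩
          · rcases eq_or_ne i' (m + 1) with rfl | hne
            · simp at hi'
            · rw [update_of_ne hne] at hi'
              have := h1 i' (by simp [hi'])
              rw [update_of_ne (by omega)]
              exact h2 i i' hii' hi'
        | alpha =>
          refine .inr (.inr ?_)
          funext i
          rcases eq_or_ne i (m + 1) with rfl | hne
          · simp [hu]
          · rw [update_of_ne hne]
            by_contra hi
            have := h1 i hi
            exact hi (h2 i (m + 1) (by omega) hu)
    · simp only [fillings, hR, if_false]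
      rw [ih]
      refine and_congr_left fun _ => forall₂_congr fun i _ => ?_
      constructor
      · rintro ⟨h1, h2, h3⟩
        exact ⟨h1, by omega, h3⟩
      · rintro ⟨h1, h2, h3⟩
        have : i ≠ m + 1 := by rintro rfl; exact hR h3
        exact ⟨h1, by omega, h3⟩

theorem fillings_eq_empty_of_lt {R : ℕ → Prop} {m : ℕ} {u : ℕ → StairSymb}
    (hu : u ∈ fillings R m) {i : ℕ} (hi : m < i) : u i = empty := by
  by_contra h
  have := (mem_fillings.1 hu).1 i h
  omega

theorem injOn_update_fillings (R : ℕ → Prop) {m k : ℕ} (hk : m < k) (σ : StairSymb) :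
    Set.InjOn (fun u => update u k σ) (fillings R m : Set (ℕ → StairSymb)) := by
  intro u hu w hw h
  funext i
  rcases eq_or_ne i k with rfl | hne
  · rw [fillings_eq_empty_of_lt hu hk, fillings_eq_empty_of_lt hw hk]
  · simpa [update_of_ne hne] using congrFun h i

theorem sum_fillings_succ {R : ℕ → Prop} {m : ℕ} (hR : R (m + 1)) (g : (ℕ → StairSymb) → ℝ) :
    ∑ u ∈ fillings R (m + 1), g u = ∑ u ∈ fillings R m, g u +
      (∑ u ∈ fillings R m, g (update u (m + 1) beta) +
        g (update (fun _ => empty) (m + 1) alpha)) := by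
  classical
  simp only [fillings, hR, if_true]
  rw [sum_union, sum_union, sum_singleton, sum_image]
  · exact injOn_update_fillings R m.lt_succ_self beta
  · rw [disjoint_singleton_right, mem_image]
    rintro ⟨u, -, h⟩
    simpa using congrFun h (m + 1)
  · rw [disjoint_left]
    intro u hu hu'
    have h0 := fillings_eq_empty_of_lt hu m.lt_succ_self
    simp only [mem_union, mem_image, mem_singleton] at hu'
    rcases hu' with ⟨w, -, rfl⟩ | rfl <;> simp at h0

/-- The weight of a column. -/
noncomputable def colWt (α β : ℝ) (u : ℕ → StairSymb) : ℝ :=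
  α ^ Set.ncard {i | u i = alpha} * β ^ Set.ncard {i | u i = beta}

theorem colWt_empty (α β : ℝ) : colWt α β (fun _ => empty) = 1 := by
  simp [colWt]

theorem finite_of_mem_fillings {R : ℕ → Prop} {m : ℕ} {u : ℕ → StairSymb}
    (hu : u ∈ fillings R m) {σ : StairSymb} (hσ : σ ≠ empty) : {i | u i = σ}.Finite := by
  refine (Set.finite_Iic m).subset fun i hi => ?_
  by_contra h
  exact hσ (hi.symm.trans (fillings_eq_empty_of_lt hu (by simpa using h)))

theorem setOf_update_self {u : ℕ → StairSymb} {k : ℕ} (σ : StairSymb) :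
    {i | update u k σ i = σ} = insert k {i | u i = σ} := by
  ext i
  rcases eq_or_ne i k with rfl | hne
  · simp
  · simp [hne]

theorem setOf_update_of_ne {u : ℕ → StairSymb} {k : ℕ} (hk : u k = empty) {σ τ : StairSymb}
    (hτ : τ ≠ empty) (h : σ ≠ τ) :
    {i | update u k σ i = τ} = {i | u i = τ} := by
  ext i
  rcases eq_or_ne i k with rfl | hne
  · simp [h, hk, hτ.symm]
  · simp [hne]

theorem colWt_update_beta (α β : ℝ) {R : ℕ → Prop} {m k : ℕ} {u : ℕ → StairSymb}
    (hu : u ∈ fillings R m) (hk : m < k) :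
    colWt α β (update u k beta) = β * colWt α β u := by
  have h0 := fillings_eq_empty_of_lt hu hk
  rw [colWt, colWt, setOf_update_self, setOf_update_of_ne h0 (by simp) (by simp),
    Set.ncard_insert_of_notMem (by simp [h0]) (finite_of_mem_fillings hu (by simp)), pow_succ]
  ring

theorem colWt_single_alpha (α β : ℝ) (k : ℕ) :
    colWt α β (update (fun _ => empty) k alpha) = α := by
  rw [colWt, setOf_update_self, setOf_update_of_ne rfl (by simp) (by simp)]
  simp

open Classical in
/-- The number of rows among `1, …, m` satisfying `R`. -/
noncomputable def rowCount (R : ℕ → Prop) (m : ℕ) : ℕ :=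
  #{i ∈ Icc 1 m | R i}

theorem rowCount_succ (R : ℕ → Prop) [DecidablePred R] (m : ℕ) :
    rowCount R (m + 1) = rowCount R m + if R (m + 1) then 1 else 0 := by
  classical
  rw [rowCount, rowCount, ← insert_Icc_right_eq_Icc_add_one (by omega), filter_insert]
  split_ifs with h
  · rw [card_insert_of_notMem (by simp)]
  · rfl

theorem rowCount_congr {R R' : ℕ → Prop} {m : ℕ} (h : ∀ i, 1 ≤ i → i ≤ m → (R i ↔ R' i)) :
    rowCount R m = rowCount R' m := by
  classical
  unfold rowCount
  congr 1
  refine filter_congr fun i hi => ?_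
  rw [mem_Icc] at hi
  exact h i hi.1 hi.2

theorem rowCount_zero (R : ℕ → Prop) : rowCount R 0 = 0 := by
  simp [rowCount]

/-- Weighted enumeration of the fillings by the number of rows left without `β`. -/
theorem sum_fillings (α β x : ℝ) (R : ℕ → Prop) (m : ℕ) :
    β * ∑ u ∈ fillings R m, colWt α β u * x ^ rowCount (fun i => R i ∧ u i ≠ beta) m =
      (α * x + β) * (x + β) ^ rowCount R m - α * x * x ^ rowCount R m := by
  classical
  induction m with
  | zero => simp [fillings, colWt_empty, rowCount_zero]
  | succ m ih =>
    by_cases hR : R (m + 1)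
    · have h1 : ∀ u ∈ fillings R m,
          colWt α β u * x ^ rowCount (fun i => R i ∧ u i ≠ beta) (m + 1) =
            x * (colWt α β u * x ^ rowCount (fun i => R i ∧ u i ≠ beta) m) := fun u hu => by
        rw [rowCount_succ, if_pos ⟨hR, by simp [fillings_eq_empty_of_lt hu m.lt_succ_self]⟩,
          pow_succ]
        ring
      have h2 : ∀ u ∈ fillings R m, colWt α β (update u (m + 1) beta) *
          x ^ rowCount (fun i => R i ∧ update u (m + 1) beta i ≠ beta) (m + 1) =
            β * (colWt α β u * x ^ rowCount (fun i => R i ∧ u i ≠ beta) m) := fun u hu => by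
        rw [rowCount_succ, if_neg (by simp), colWt_update_beta α β hu m.lt_succ_self, add_zero,
          rowCount_congr (R' := fun i => R i ∧ u i ≠ beta), mul_assoc]
        intro i _ hi
        rw [update_of_ne (by omega)]
      have h3 : rowCount (fun i => R i ∧ update (fun _ => empty) (m + 1) alpha i ≠ beta) (m + 1) =
          rowCount R (m + 1) := by
        refine rowCount_congr fun i _ _ => ?_
        rcases eq_or_ne i (m + 1) with rfl | hne
        · simp
        · simp [hne]
      rw [sum_fillings_succ hR, sum_congr rfl h1, sum_congr rfl h2, ← mul_sum, ← mul_sum, h3,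
        colWt_single_alpha, rowCount_succ R, if_pos hR, pow_succ, pow_succ]
      linear_combination (x + β) * ih
    · have hf : fillings R (m + 1) = fillings R m := by simp [fillings, hR]
      rw [hf, rowCount_succ R, if_neg hR, add_zero, ← ih]
      congr 1
      refine sum_congr rfl fun u _ => ?_
      rw [rowCount_succ, if_neg (by simp [hR]), add_zero]

/-- Weighted enumeration of the fillings, with `t` marking an `α` in the lowest row. -/
theorem sum_fillings_mark (α β x t : ℝ) (R : ℕ → Prop) [DecidablePred R] (m : ℕ)
    (h0 : ¬ R 0) :
    β * ∑ u ∈ fillings R m, colWt α β u * x ^ rowCount (fun i => R i ∧ u i ≠ beta) m *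
        (if u m = alpha then t else 1) =
      (α * x + β) * (x + β) ^ rowCount R m - α * x * x ^ rowCount R m +
        if R m then (t - 1) * α * β * x ^ rowCount R m else 0 := by
  classical
  rw [← sum_fillings]
  cases m with
  | zero => simp [fillings, h0]
  | succ m =>
    by_cases hR : R (m + 1)
    · have h1 : ∀ u ∈ fillings R m, ¬ u (m + 1) = alpha := fun u hu => by
        simp [fillings_eq_empty_of_lt hu m.lt_succ_self]
      have h3 : rowCount (fun i => R i ∧ update (fun _ => empty) (m + 1) alpha i ≠ beta) (m + 1) =
          rowCount R (m + 1) := by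
        refine rowCount_congr fun i _ _ => ?_
        rcases eq_or_ne i (m + 1) with rfl | hne
        · simp
        · simp [hne]
      rw [sum_fillings_succ hR, sum_fillings_succ hR, if_pos hR, h3, colWt_single_alpha]
      simp only [update_self, if_true, reduceCtorEq, if_false, mul_one]
      rw [sum_congr rfl fun u hu => by rw [if_neg (h1 u hu), mul_one]]
      ring
    · have hf : fillings R (m + 1) = fillings R m := by simp [fillings, hR]
      rw [hf, if_neg hR, add_zero]
      congr 1
      refine sum_congr rfl fun u hu => ?_
      rw [if_neg (by simp [fillings_eq_empty_of_lt hu m.lt_succ_self]), mul_one]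

/-- The array obtained from `T` by inserting the column `v` before its first column. -/
def consCol (v : ℕ → StairSymb) (T : ℕ → ℕ → StairSymb) : ℕ → ℕ → StairSymb
  | _, 0 => empty
  | i, 1 => v i
  | i, j + 2 => T i (j + 1)

/-- Row `i` of `T` contains no `β`, so that a box may be filled to its left. -/
def IsFree (T : ℕ → ℕ → StairSymb) (i : ℕ) : Prop :=
  1 ≤ i ∧ ∀ j, T i j ≠ beta

/-- The admissible first columns of a tableau of size `n + 1`, when `R` describes the free rows
of the remaining tableau of size `n`. -/
noncomputable def firstCols (R : ℕ → Prop) (n : ℕ) : Finset (ℕ → StairSymb) :=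
  {v ∈ fillings (fun i => R i ∨ i = n + 1) (n + 1) | v (n + 1) ≠ empty}

theorem sum_firstCols (R : ℕ → Prop) (n : ℕ) (g : (ℕ → StairSymb) → ℝ) :
    ∑ v ∈ firstCols R n, g v = g (update (fun _ => empty) (n + 1) alpha) +
      ∑ u ∈ fillings R n, g (update u (n + 1) beta) := by
  have h : fillings (fun i => R i ∨ i = n + 1) n = fillings R n := by
    ext u
    rw [mem_fillings, mem_fillings]
    refine and_congr_left fun _ => forall₂_congr fun i _ => ?_
    constructor
    · rintro ⟨h1, h2, h3 | h3⟩
      · exact ⟨h1, h2, h3⟩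
      · omega
    · exact fun ⟨h1, h2, h3⟩ => ⟨h1, h2, .inl h3⟩
  rw [firstCols, sum_filter, sum_fillings_succ (.inr rfl), h,
    sum_eq_zero fun u hu => if_neg (by simp [fillings_eq_empty_of_lt hu n.lt_succ_self])]
  simp [add_comm]

open Classical in
/-- The staircase tableaux of size `n`, built column by column from right to left. -/
noncomputable def tableaux : ℕ → Finset (ℕ → ℕ → StairSymb)
  | 0 => {fun _ _ => empty}
  | n + 1 => (tableaux n).biUnion fun T => (firstCols (IsFree T) n).image fun v => consCol v T

theorem isStaircase_consCol {n : ℕ} {T : ℕ → ℕ → StairSymb} {v : ℕ → StairSymb}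
    (hT : IsStaircase n T) (hv : v ∈ firstCols (IsFree T) n) :
    IsStaircase (n + 1) (consCol v T) := by
  rw [firstCols, mem_filter, mem_fillings] at hv
  obtain ⟨⟨hv1, hv2⟩, hv3⟩ := hv
  obtain ⟨h1, h2, h3, h4⟩ := hT
  refine ⟨fun i j hij => ?_, fun i i' j hi hii' hj hij h => ?_, fun i j j' hi hj hjj' hij h => ?_,
    fun i j hi hj hij => ?_⟩
  · match j with
    | 0 => rfl
    | 1 =>
      by_contra h
      have := hv1 i h
      omega
    | j + 2 => exact h1 i (j + 1) (by omega)
  · match j with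
    | 1 => exact hv2 i i' hii' h
    | j + 2 => exact h2 i i' (j + 1) hi hii' (by omega) (by omega) h
  · match j, j' with
    | 1, j' + 2 =>
      by_contra hne
      obtain ⟨-, -, hR | rfl⟩ := hv1 i hne
      · exact hR.2 _ h
      · omega
    | j + 2, j' + 2 => exact h3 i (j + 1) (j' + 1) hi (by omega) (by omega) (by omega) h
    | j + 2, 1 => omega
  · match j with
    | 1 =>
      obtain rfl : i = n + 1 := by omega
      exact hv3
    | j + 2 => exact h4 i (j + 1) hi (by omega) (by omega)

theorem exists_eq_consCol {n : ℕ} {S : ℕ → ℕ → StairSymb} (hS : IsStaircase (n + 1) S) :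
    ∃ T, IsStaircase n T ∧ ∃ v ∈ firstCols (IsFree T) n, consCol v T = S := by
  obtain ⟨h1, h2, h3, h4⟩ := hS
  have hbox : ∀ i j, S i j ≠ empty → 1 ≤ i ∧ 1 ≤ j ∧ i + j ≤ n + 1 + 1 := fun i j h => by
    by_contra h'
    exact h (h1 i j h')
  refine ⟨fun i j => if j = 0 then empty else S i (j + 1), ⟨fun i j hij => ?_,
    fun i i' j hi hii' hj hij h => ?_, fun i j j' hi hj hjj' hij h => ?_,
    fun i j hi hj hij => ?_⟩, fun i => S i 1, ?_, ?_⟩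
  · rcases eq_or_ne j 0 with rfl | hj
    · simp
    · simpa [hj] using h1 i (j + 1) (by omega)
  · simp only [show j ≠ 0 by omega, if_false] at h ⊢
    exact h2 i i' (j + 1) hi hii' (by omega) (by omega) h
  · simp only [show j ≠ 0 by omega, show j' ≠ 0 by omega, if_false] at h ⊢
    exact h3 i (j + 1) (j' + 1) hi (by omega) (by omega) (by omega) h
  · simp only [show j ≠ 0 by omega, if_false]
    exact h4 i (j + 1) hi (by omega) (by omega)
  · rw [firstCols, mem_filter, mem_fillings]
    refine ⟨⟨fun i hi => ?_, fun i i' hii' h => ?_⟩, h4 _ _ (by omega) (by omega) (by omega)⟩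
    · have hb := hbox i 1 hi
      refine ⟨hb.1, by omega, .inl ⟨hb.1, fun j hj => ?_⟩⟩
      dsimp only at hj
      split_ifs at hj with hj0
      exact hi (h3 i 1 (j + 1) hb.1 le_rfl (by omega) (hbox i (j + 1) (by simp [hj])).2.2 hj)
    · rcases Nat.eq_zero_or_pos i with rfl | hi
      · exact h1 _ _ (by omega)
      · exact h2 i i' 1 hi hii' le_rfl (hbox i' 1 (by simp [h])).2.2 h
  · funext i j
    match j with
    | 0 => exact (h1 i 0 (by omega)).symm
    | 1 => rfl
    | j + 2 => simp [consCol]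

theorem mem_tableaux {n : ℕ} {S : ℕ → ℕ → StairSymb} : S ∈ tableaux n ↔ IsStaircase n S := by
  induction n generalizing S with
  | zero =>
    rw [tableaux, mem_singleton]
    constructor
    · rintro rfl
      refine ⟨by simp, by simp, by simp, fun i j hi hj hij => by omega⟩
    · rintro ⟨h, -⟩
      funext i j
      exact h i j (by omega)
  | succ n ih =>
    simp only [tableaux, mem_biUnion, mem_image, ih]
    constructor
    · rintro ⟨T, hT, v, hv, rfl⟩
      exact isStaircase_consCol hT hv
    · exact exists_eq_consCol

theorem col_zero_eq_empty {n : ℕ} {T : ℕ → ℕ → StairSymb} (hT : T ∈ tableaux n) (i : ℕ) :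
    T i 0 = empty :=
  (mem_tableaux.1 hT).1 i 0 (by omega)

theorem consCol_inj {v v' : ℕ → StairSymb} {T T' : ℕ → ℕ → StairSymb} (hT : ∀ i, T i 0 = empty)
    (hT' : ∀ i, T' i 0 = empty) (h : consCol v T = consCol v' T') : v = v' ∧ T = T' := by
  refine ⟨funext fun i => congrFun₂ h i 1, funext₂ fun i j => ?_⟩
  cases j with
  | zero => rw [hT, hT']
  | succ j => exact congrFun₂ h i (j + 2)

theorem sum_tableaux_succ (n : ℕ) (g : (ℕ → ℕ → StairSymb) → ℝ) :
    ∑ S ∈ tableaux (n + 1), g S =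
      ∑ T ∈ tableaux n, (g (consCol (update (fun _ => empty) (n + 1) alpha) T) +
        ∑ u ∈ fillings (IsFree T) n, g (consCol (update u (n + 1) beta) T)) := by
  classical
  rw [tableaux, sum_biUnion]
  · refine sum_congr rfl fun T hT => ?_
    rw [sum_image, sum_firstCols (g := fun v => g (consCol v T))]
    exact fun v _ v' _ h => (consCol_inj (col_zero_eq_empty hT) (col_zero_eq_empty hT) h).1
  · intro T hT T' hT' hne
    rw [onFun, disjoint_left]
    intro S hS hS'
    obtain ⟨v, -, rfl⟩ := mem_image.1 hS
    obtain ⟨v', -, h⟩ := mem_image.1 hS'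
    exact hne (consCol_inj (col_zero_eq_empty hT') (col_zero_eq_empty hT) h).2.symm

theorem isFree_consCol {v : ℕ → StairSymb} {T : ℕ → ℕ → StairSymb} (hT : ∀ i, T i 0 = empty)
    (i : ℕ) : IsFree (consCol v T) i ↔ IsFree T i ∧ v i ≠ beta := by
  constructor
  · rintro ⟨h1, h2⟩
    refine ⟨⟨h1, fun j => ?_⟩, h2 1⟩
    cases j with
    | zero => simp [hT]
    | succ j => exact h2 (j + 2)
  · rintro ⟨⟨h1, h2⟩, h3⟩
    refine ⟨h1, fun j => ?_⟩
    match j with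
    | 0 => simp [consCol]
    | 1 => exact h3
    | j + 2 => exact h2 (j + 1)

theorem finite_of_mem_tableaux {n : ℕ} {T : ℕ → ℕ → StairSymb} (hT : T ∈ tableaux n)
    {σ : StairSymb} (hσ : σ ≠ empty) : {p : ℕ × ℕ | T p.1 p.2 = σ}.Finite := by
  refine ((Set.finite_Iic (n + 1)).prod (Set.finite_Iic (n + 1))).subset fun p hp => ?_
  by_contra h
  refine hσ (hp.symm.trans ((mem_tableaux.1 hT).1 _ _ fun h' => h ?_))
  simp only [Set.mem_prod, Set.mem_Iic]
  omega

theorem ncard_consCol {n : ℕ} {T : ℕ → ℕ → StairSymb} (hT : T ∈ tableaux n) {v : ℕ → StairSymb}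
    {σ : StairSymb} (hσ : σ ≠ empty) (hv : {i | v i = σ}.Finite) :
    {p : ℕ × ℕ | consCol v T p.1 p.2 = σ}.ncard =
      {i | v i = σ}.ncard + {p : ℕ × ℕ | T p.1 p.2 = σ}.ncard := by
  have hinj : Injective fun i : ℕ => (i, 1) := fun i i' h => by simpa using h
  have hinj' : Injective fun p : ℕ × ℕ => (p.1, p.2 + 1) := fun p p' h => by
    simpa [Prod.ext_iff] using h
  have hunion : {p : ℕ × ℕ | consCol v T p.1 p.2 = σ} =
      (fun i : ℕ => (i, 1)) '' {i | v i = σ} ∪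
        (fun p : ℕ × ℕ => (p.1, p.2 + 1)) '' {p : ℕ × ℕ | T p.1 p.2 = σ} := by
    ext ⟨i, j⟩
    match j with
    | 0 => simp [consCol, hσ.symm]
    | 1 => simp [consCol, col_zero_eq_empty hT, hσ.symm]
    | j + 2 => simp [consCol]
  rw [hunion, Set.ncard_union_eq ?_ (hv.image _) ((finite_of_mem_tableaux hT hσ).image _),
    Set.ncard_image_of_injective _ hinj, Set.ncard_image_of_injective _ hinj']
  rw [Set.disjoint_left]
  rintro _ ⟨i, -, rfl⟩ ⟨p, hp, h⟩
  simp only [Prod.mk.injEq, Nat.add_eq_right] at h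
  rw [Set.mem_ofPred_eq, h.2, col_zero_eq_empty hT] at hp
  exact hσ hp.symm

theorem stairWt_consCol (α β : ℝ) {n : ℕ} {T : ℕ → ℕ → StairSymb} (hT : T ∈ tableaux n)
    {v : ℕ → StairSymb} (hv : {i | v i ≠ empty}.Finite) :
    stairWt α β (consCol v T) = colWt α β v * stairWt α β T := by
  have hfin : ∀ σ, σ ≠ empty → {i | v i = σ}.Finite := fun σ hσ =>
    hv.subset fun i (hi : v i = σ) => show v i ≠ empty from hi ▸ hσ
  rw [stairWt, stairWt, colWt, ncard_consCol hT (by simp) (hfin _ (by simp)),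
    ncard_consCol hT (by simp) (hfin _ (by simp)), pow_add, pow_add]
  ring

/-- The number of `α`s on the second main diagonal of an array of size `n`. -/
def diagAlphas (n : ℕ) (S : ℕ → ℕ → StairSymb) : ℕ :=
  #{j ∈ Icc 1 (n - 1) | S (n - j) j = alpha}

theorem diagAlphas_consCol (n : ℕ) (T : ℕ → ℕ → StairSymb) {v : ℕ → StairSymb}
    (hv : v 0 = empty) :
    diagAlphas (n + 1) (consCol v T) = diagAlphas n T + if v n = alpha then 1 else 0 := by
  have h : ∀ m : ℕ, Icc 1 m = Ico 1 (m + 1) := fun m => by ext; simp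
  cases n with
  | zero => simp [diagAlphas, hv]
  | succ n =>
    rw [diagAlphas, diagAlphas, card_filter, card_filter, h, h, sum_Ico_eq_sum_range,
      sum_Ico_eq_sum_range]
    simp only [Nat.add_sub_cancel]
    rw [sum_range_succ']
    refine congrArg₂ _ (sum_congr rfl fun j hj => ?_) ?_
    · rw [show n + 1 + 1 - (1 + (j + 1)) = n + 1 - (1 + j) by omega,
        show 1 + (j + 1) = j + 2 by omega, add_comm 1 j]
      rfl
    · rfl

/-- The joint generating function of the weight, of the number of free rows (marked by `x`) and of
the number of `α`s on the second main diagonal (marked by `t`). -/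
noncomputable def gf (α β x t : ℝ) (n : ℕ) : ℝ :=
  ∑ T ∈ tableaux n, stairWt α β T * x ^ rowCount (IsFree T) n * t ^ diagAlphas n T

open Classical in
/-- The part of `gf` coming from the tableaux whose last row is free. -/
noncomputable def gfFree (α β x t : ℝ) (n : ℕ) : ℝ :=
  ∑ T ∈ tableaux n,
    if IsFree T n then stairWt α β T * x ^ rowCount (IsFree T) n * t ^ diagAlphas n T else 0

theorem isFree_of_mem_tableaux {n : ℕ} {T : ℕ → ℕ → StairSymb} (hT : T ∈ tableaux n) :
    IsFree T (n + 1) :=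
  ⟨by omega, fun j => by rw [(mem_tableaux.1 hT).1 (n + 1) j (by omega)]; simp⟩

theorem rowCount_consCol {n : ℕ} {T : ℕ → ℕ → StairSymb} (hT : T ∈ tableaux n)
    (v : ℕ → StairSymb) :
    rowCount (IsFree (consCol v T)) (n + 1) = rowCount (fun i => IsFree T i ∧ v i ≠ beta) n +
      if v (n + 1) ≠ beta then 1 else 0 := by
  classical
  rw [rowCount_succ]
  congr 1
  · exact rowCount_congr fun i _ _ => isFree_consCol (col_zero_eq_empty hT) i
  · simp only [isFree_consCol (col_zero_eq_empty hT), isFree_of_mem_tableaux hT, true_and]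

theorem finite_update {u : ℕ → StairSymb} {m : ℕ} (h : ∀ i, m < i → u i = empty) (k : ℕ)
    (σ : StairSymb) : {i | update u k σ i ≠ empty}.Finite := by
  refine (Set.finite_Iic (max m k)).subset fun i hi => ?_
  by_contra h'
  rw [Set.mem_Iic, not_le, max_lt_iff] at h'
  exact hi (by rw [update_of_ne (by omega), h i h'.1])

theorem summand_consCol_alpha (α β x t : ℝ) {n : ℕ} {T : ℕ → ℕ → StairSymb} (hT : T ∈ tableaux n) :
    stairWt α β (consCol (update (fun _ => empty) (n + 1) alpha) T) *
      x ^ rowCount (IsFree (consCol (update (fun _ => empty) (n + 1) alpha) T)) (n + 1) *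
      t ^ diagAlphas (n + 1) (consCol (update (fun _ => empty) (n + 1) alpha) T) =
    α * x * (stairWt α β T * x ^ rowCount (IsFree T) n * t ^ diagAlphas n T) := by
  rw [stairWt_consCol α β hT (finite_update (m := 0) (by simp) _ _), colWt_single_alpha,
    rowCount_consCol hT, diagAlphas_consCol n T (by simp), rowCount_congr (R' := IsFree T)]
  · simp [pow_succ]
    ring
  · intro i _ hi
    simp [update_of_ne (show i ≠ n + 1 by omega)]

theorem summand_consCol_beta (α β x t : ℝ) {n : ℕ} {T : ℕ → ℕ → StairSymb} (hT : T ∈ tableaux n)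
    {u : ℕ → StairSymb} (hu : u ∈ fillings (IsFree T) n) :
    stairWt α β (consCol (update u (n + 1) beta) T) *
      x ^ rowCount (IsFree (consCol (update u (n + 1) beta) T)) (n + 1) *
      t ^ diagAlphas (n + 1) (consCol (update u (n + 1) beta) T) =
    β * (colWt α β u * x ^ rowCount (fun i => IsFree T i ∧ u i ≠ beta) n *
      (if u n = alpha then t else 1)) * (stairWt α β T * t ^ diagAlphas n T) := by
  have hu0 : u 0 = empty := by
    by_contra h
    have := (mem_fillings.1 hu).1 0 h
    omega
  rw [stairWt_consCol α β hT (finite_update (fun i => fillings_eq_empty_of_lt hu) _ _),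
    colWt_update_beta α β hu n.lt_succ_self, rowCount_consCol hT,
    diagAlphas_consCol n T (by simpa using hu0),
    rowCount_congr (R' := fun i => IsFree T i ∧ u i ≠ beta)]
  · rw [update_self, if_neg (by simp), update_of_ne (show n ≠ n + 1 by omega)]
    split_ifs
    · rw [pow_succ]
      ring
    · rw [add_zero, add_zero]
      ring
  · intro i _ hi
    simp [update_of_ne (show i ≠ n + 1 by omega)]

theorem gf_succ (α β x t : ℝ) (n : ℕ) :
    gf α β x t (n + 1) = (α * x + β) * gf α β (x + β) t n +
      (t - 1) * α * β * gfFree α β x t n := by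
  classical
  rw [gf, sum_tableaux_succ, gf, gfFree, mul_sum, mul_sum, ← sum_add_distrib]
  refine sum_congr rfl fun T hT => ?_
  rw [summand_consCol_alpha α β x t hT,
    sum_congr rfl fun u hu => summand_consCol_beta α β x t hT hu, ← sum_mul, ← mul_sum,
    sum_fillings_mark α β x t (IsFree T) n (fun h => by simpa using h.1)]
  split_ifs <;> ring

theorem gfFree_succ (α β x t : ℝ) (n : ℕ) :
    gfFree α β x t (n + 1) = α * x * gf α β x t n := by
  classical
  rw [gfFree, sum_tableaux_succ, gf, mul_sum]
  refine sum_congr rfl fun T hT => ?_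
  rw [sum_eq_zero fun u _ => if_neg fun h =>
      ((isFree_consCol (col_zero_eq_empty hT) _).1 h).2 (by simp), add_zero,
    if_pos ((isFree_consCol (col_zero_eq_empty hT) _).2 ⟨isFree_of_mem_tableaux hT, by simp⟩),
    summand_consCol_alpha α β x t hT]

theorem gf_zero (α β x t : ℝ) : gf α β x t 0 = 1 := by
  simp [gf, tableaux, rowCount_zero, diagAlphas, stairWt]

theorem gf_one (α β x t : ℝ) : gf α β x t 1 = α * x + β := by
  rw [gf_succ, gf_zero, gfFree, tableaux, sum_singleton, if_neg fun h => by simpa using h.1]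
  ring

theorem gf_add_two (α β x t : ℝ) (n : ℕ) :
    gf α β x t (n + 2) = (α * x + β) * gf α β (x + β) t (n + 1) +
      (t - 1) * (α ^ 2 * β * x) * gf α β x t n := by
  rw [gf_succ, gfFree_succ]
  ring

open Polynomial Filter Topology

/-- The factor `α x + β` at `x = 1 + i β`. -/
def aCoef (α β : ℝ) (i : ℕ) : ℝ := α * (1 + i * β) + β

/-- The factor `α² β x` at `x = 1 + i β`. -/
def bCoef (α β : ℝ) (i : ℕ) : ℝ := α ^ 2 * β * (1 + i * β)

/-- The generating function `gf` at `x = 1 + i β`, as a polynomial in `t - 1`. -/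
noncomputable def recPoly (α β : ℝ) : ℕ → ℕ → ℝ[X]
  | 0, _ => 1
  | 1, i => C (aCoef α β i)
  | n + 2, i => C (aCoef α β i) * recPoly α β (n + 1) (i + 1) +
      C (bCoef α β i) * (X * recPoly α β n i)

theorem eval_recPoly (α β t : ℝ) (n i : ℕ) :
    (recPoly α β n i).eval (t - 1) = gf α β (1 + i * β) t n := by
  induction n using Nat.twoStepInduction generalizing i with
  | zero => simp [recPoly, gf_zero]
  | one => simp [recPoly, gf_one, aCoef]
  | more n ih ih' =>
    rw [gf_add_two, recPoly, eval_add, eval_mul, eval_mul, eval_mul, eval_C, eval_C, eval_X, ih,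
      ih', show (1 : ℝ) + ((i + 1 : ℕ) : ℝ) * β = 1 + i * β + β by push_cast; ring, aCoef, bCoef]
    ring

/-- The weights in the recurrence for the normalized coefficients of `recPoly`. -/
noncomputable def stepWt (α β : ℝ) (N j : ℕ) : ℝ :=
  bCoef α β j / (aCoef α β (N - 2) * aCoef α β (N - 1))

/-- The normalized coefficients of `recPoly`, that is, the binomial moments of the number of
`α`s on the second main diagonal. -/
noncomputable def moment (α β : ℝ) : ℕ → ℕ → ℕ → ℝ
  | 0, _, _ => 1
  | r + 1, N, i => ∑ j ∈ Ico i (N - 1), stepWt α β N j * moment α β r (N - 2) j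

variable {α β : ℝ}

theorem aCoef_pos (hα : 0 < α) (hβ : 0 < β) (i : ℕ) : 0 < aCoef α β i := by
  unfold aCoef
  positivity

theorem bCoef_pos (hα : 0 < α) (hβ : 0 < β) (i : ℕ) : 0 < bCoef α β i := by
  unfold bCoef
  positivity

theorem stepWt_nonneg (hα : 0 < α) (hβ : 0 < β) (N j : ℕ) : 0 ≤ stepWt α β N j :=
  div_nonneg (bCoef_pos hα hβ j).le (mul_pos (aCoef_pos hα hβ _) (aCoef_pos hα hβ _)).le

theorem coeff_recPoly (hα : 0 < α) (hβ : 0 < β) (n i r : ℕ) :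
    (recPoly α β n i).coeff r = (∏ j ∈ range n, aCoef α β (i + j)) * moment α β r (n + i) i := by
  induction n using Nat.twoStepInduction generalizing i r with
  | zero =>
    cases r with
    | zero => simp [recPoly, moment]
    | succ r => simp [recPoly, moment, coeff_one]
  | one =>
    cases r with
    | zero => simp [recPoly, moment]
    | succ r => simp [recPoly, moment]
  | more n ih ih' =>
    have hprod : ∏ j ∈ range (n + 2), aCoef α β (i + j) =
        aCoef α β i * ∏ j ∈ range (n + 1), aCoef α β (i + 1 + j) := by
      rw [prod_range_succ', mul_comm]
      simp only [add_zero, add_assoc, add_comm 1]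
    rw [recPoly, coeff_add, coeff_C_mul, coeff_C_mul, ih', ← mul_assoc, ← hprod,
      show n + 1 + (i + 1) = n + 2 + i by ring]
    cases r with
    | zero => simp [moment]
    | succ r =>
      rw [coeff_X_mul, ih, moment, moment, sum_eq_sum_Ico_succ_bot (by omega : i < n + 2 + i - 1),
        mul_add, add_comm, prod_range_succ, prod_range_succ, stepWt,
        show n + 2 + i - 2 = i + n by omega, show n + 2 + i - 1 = i + (n + 1) by omega,
        add_comm n i]
      have h1 := (aCoef_pos hα hβ (i + n)).ne'
      have h2 := (aCoef_pos hα hβ (i + (n + 1))).ne'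
      field_simp

theorem moment_nonneg (hα : 0 < α) (hβ : 0 < β) (r N i : ℕ) : 0 ≤ moment α β r N i := by
  induction r generalizing N i with
  | zero => simp [moment]
  | succ r ih => exact sum_nonneg fun j _ => mul_nonneg (stepWt_nonneg hα hβ N j) (ih _ _)

theorem moment_one (N i : ℕ) : moment α β 1 N i = ∑ j ∈ Ico i (N - 1), stepWt α β N j := by
  simp [moment]

theorem sum_bCoef (α β : ℝ) (m : ℕ) :
    ∑ j ∈ range (m + 1), bCoef α β j = α * β * (m + 1) * (α * (1 + m * β / 2)) := by
  induction m with
  | zero => simp [bCoef]; ring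
  | succ m ih =>
    rw [sum_range_succ, ih, bCoef]
    push_cast
    ring

theorem moment_one_add_two (m : ℕ) :
    moment α β 1 (m + 2) 0 =
      (α * β + α * β * m) / (α + α * β + β + α * β * m) *
        ((α + α * β / 2 * m) / (α + β + α * β * m)) := by
  rw [moment_one]
  simp only [stepWt]
  rw [← sum_div, ← range_eq_Ico, show m + 2 - 1 = m + 1 by omega, sum_bCoef, aCoef, aCoef,
    div_mul_div_comm, show m + 2 - 2 = m by omega]
  push_cast
  congr 1 <;> ring

/-- A uniform bound for the total weight of a step. -/
noncomputable def ratio (α β : ℝ) : ℝ := max (1 / 2) (α / (α + β))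

theorem ratio_pos (α β : ℝ) : 0 < ratio α β := lt_max_of_lt_left (by norm_num)

theorem ratio_lt_one (hα : 0 < α) (hβ : 0 < β) : ratio α β < 1 :=
  max_lt (by norm_num) ((div_lt_one (by positivity)).2 (by linarith))

theorem moment_one_le_ratio (hα : 0 < α) (hβ : 0 < β) (N i : ℕ) :
    moment α β 1 N i ≤ ratio α β := by
  have h0 : moment α β 1 N i ≤ moment α β 1 N 0 := by
    rw [moment_one, moment_one]
    exact sum_le_sum_of_subset_of_nonneg (Ico_subset_Ico_left i.zero_le)
      fun j _ _ => stepWt_nonneg hα hβ N j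
  refine h0.trans ?_
  match N with
  | 0 => simpa [moment] using (ratio_pos α β).le
  | 1 => simpa [moment] using (ratio_pos α β).le
  | m + 2 =>
    rw [moment_one_add_two]
    have h1 : (α * β + α * β * m) / (α + α * β + β + α * β * m) ≤ 1 :=
      (div_le_one (by positivity)).2 (by linarith)
    have h2 : (α + α * β / 2 * m) / (α + β + α * β * m) ≤ ratio α β := by
      rw [div_le_iff₀ (by positivity)]
      have h3 : α ≤ ratio α β * (α + β) := (div_le_iff₀ (by positivity)).1 (le_max_right _ _)
      have h4 : 1 / 2 * (α * β * m) ≤ ratio α β * (α * β * m) :=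
        mul_le_mul_of_nonneg_right (le_max_left _ _) (by positivity)
      linarith
    calc _ ≤ 1 * ratio α β := mul_le_mul h1 h2 (by positivity) zero_le_one
      _ = _ := one_mul _

theorem moment_le_ratio_pow (hα : 0 < α) (hβ : 0 < β) (r N i : ℕ) :
    moment α β r N i ≤ ratio α β ^ r := by
  induction r generalizing N i with
  | zero => simp [moment]
  | succ r ih =>
    calc moment α β (r + 1) N i ≤ ∑ j ∈ Ico i (N - 1), stepWt α β N j * ratio α β ^ r :=
          sum_le_sum fun j _ => mul_le_mul_of_nonneg_left (ih _ _) (stepWt_nonneg hα hβ N j)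
      _ = moment α β 1 N i * ratio α β ^ r := by rw [moment_one, sum_mul]
      _ ≤ ratio α β * ratio α β ^ r :=
          mul_le_mul_of_nonneg_right (moment_one_le_ratio hα hβ N i) (pow_pos (ratio_pos α β) r).le
      _ = _ := (pow_succ' _ _).symm

theorem moment_one_le_one (hα : 0 < α) (hβ : 0 < β) (N i : ℕ) : moment α β 1 N i ≤ 1 :=
  (moment_one_le_ratio hα hβ N i).trans (ratio_lt_one hα hβ).le

theorem tendsto_moment_one (hα : 0 < α) (hβ : 0 < β) :
    Tendsto (fun N => moment α β 1 N 0) atTop (𝓝 (1 / 2)) := by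
  rw [← tendsto_add_atTop_iff_nat 2]
  simp only [moment_one_add_two]
  have h : α * β ≠ 0 := by positivity
  convert (tendsto_add_mul_div_add_mul_atTop_nhds (α * β) (α + α * β + β) (α * β) h).mul
    (tendsto_add_mul_div_add_mul_atTop_nhds α (α + β) (α * β / 2) h) using 2
  field_simp

/-- The largest weight of a step. -/
noncomputable def maxWt (α β : ℝ) (N : ℕ) : ℝ := stepWt α β N (N - 2)

theorem stepWt_le_maxWt (hα : 0 < α) (hβ : 0 < β) {N j : ℕ} (hj : j ≤ N - 2) :
    stepWt α β N j ≤ maxWt α β N := by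
  have h1 := aCoef_pos hα hβ (N - 2)
  have h2 := aCoef_pos hα hβ (N - 1)
  have hj' : (j : ℝ) ≤ (N - 2 : ℕ) := by exact_mod_cast hj
  unfold maxWt stepWt bCoef
  gcongr

theorem tendsto_maxWt (hα : 0 < α) (hβ : 0 < β) : Tendsto (maxWt α β) atTop (𝓝 0) := by
  rw [← tendsto_add_atTop_iff_nat 2]
  have h : α * β ≠ 0 := by positivity
  convert (tendsto_add_mul_div_add_mul_atTop_nhds α (α + β) (α * β) h).mul
    (tendsto_add_mul_div_add_mul_atTop_nhds (α * β) (α + α * β + β) 0 h) using 2 with m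
  · rw [maxWt, stepWt, aCoef, aCoef, bCoef, div_mul_div_comm]
    simp
    congr 1 <;> ring
  · simp

/-- The ratio of the normalizations of two weights with parameters differing by two. -/
noncomputable def shiftRatio (α β : ℝ) (N : ℕ) : ℝ :=
  aCoef α β (N - 2) / aCoef α β N * (aCoef α β (N - 1) / aCoef α β (N + 1))

theorem tendsto_shiftRatio (hα : 0 < α) (hβ : 0 < β) :
    Tendsto (shiftRatio α β) atTop (𝓝 1) := by
  rw [← tendsto_add_atTop_iff_nat 2]
  have h : α * β ≠ 0 := by positivity
  convert (tendsto_add_mul_div_add_mul_atTop_nhds (α + β) (α + 2 * α * β + β) (α * β) h).mul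
    (tendsto_add_mul_div_add_mul_atTop_nhds (α + α * β + β) (α + 3 * α * β + β) (α * β) h)
    using 2 with m
  · simp only [shiftRatio, aCoef]
    simp
    congr 2 <;> ring
  · rw [div_self h, one_mul]

theorem aCoef_mono (hα : 0 < α) (hβ : 0 < β) {i j : ℕ} (h : i ≤ j) :
    aCoef α β i ≤ aCoef α β j := by
  unfold aCoef
  gcongr

theorem stepWt_add_two (hα : 0 < α) (hβ : 0 < β) (N j : ℕ) :
    stepWt α β (N + 2) j = shiftRatio α β N * stepWt α β N j := by
  have h1 := (aCoef_pos hα hβ (N - 2)).ne'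
  have h2 := (aCoef_pos hα hβ (N - 1)).ne'
  have h3 := (aCoef_pos hα hβ N).ne'
  have h4 := (aCoef_pos hα hβ (N + 1)).ne'
  rw [stepWt, stepWt, shiftRatio, show N + 2 - 2 = N by omega, show N + 2 - 1 = N + 1 by omega]
  field_simp

theorem shiftRatio_le_one (hα : 0 < α) (hβ : 0 < β) (N : ℕ) : shiftRatio α β N ≤ 1 :=
  mul_le_one₀ ((div_le_one (aCoef_pos hα hβ _)).2 (aCoef_mono hα hβ (by omega)))
    (div_pos (aCoef_pos hα hβ _) (aCoef_pos hα hβ _)).le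
    ((div_le_one (aCoef_pos hα hβ _)).2 (aCoef_mono hα hβ (by omega)))

theorem abs_moment_one_sub_le (hα : 0 < α) (hβ : 0 < β) {N : ℕ} (hN : 1 ≤ N) (j : ℕ) :
    |moment α β 1 (N + 2) j - moment α β 1 N j| ≤
      (1 - shiftRatio α β N) + 2 * maxWt α β (N + 2) := by
  have hρ := shiftRatio_le_one hα hβ N
  have hW : 0 ≤ maxWt α β (N + 2) := stepWt_nonneg hα hβ _ _
  have hy0 := moment_nonneg hα hβ 1 N j
  have hy1 := moment_one_le_one hα hβ N j
  have hsum : ∑ i ∈ Ico j (N - 1), stepWt α β (N + 2) i =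
      shiftRatio α β N * moment α β 1 N j := by
    rw [moment_one, mul_sum]
    exact sum_congr rfl fun i _ => stepWt_add_two hα hβ N i
  have hlo : shiftRatio α β N * moment α β 1 N j ≤ moment α β 1 (N + 2) j := by
    rw [← hsum, moment_one]
    exact sum_le_sum_of_subset_of_nonneg (Ico_subset_Ico_right (by omega))
      fun i _ _ => stepWt_nonneg hα hβ _ i
  have hhi : moment α β 1 (N + 2) j ≤
      shiftRatio α β N * moment α β 1 N j + 2 * maxWt α β (N + 2) := by
    have hsub : Ico j (N + 2 - 1) ⊆ Ico j (N - 1) ∪ Ico (N - 1) (N + 1) := fun i hi => by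
      simp only [mem_union, mem_Ico] at hi ⊢
      omega
    have hdisj : Disjoint (Ico j (N - 1)) (Ico (N - 1) (N + 1)) :=
      Ico_disjoint_Ico_consecutive _ _ _
    have hlast : ∑ i ∈ Ico (N - 1) (N + 1), stepWt α β (N + 2) i ≤ 2 * maxWt α β (N + 2) := by
      refine (sum_le_card_nsmul _ _ (maxWt α β (N + 2)) fun i hi => ?_).trans_eq ?_
      · exact stepWt_le_maxWt hα hβ (by rw [mem_Ico] at hi; omega)
      · rw [Nat.card_Ico, show N + 1 - (N - 1) = 2 by omega, nsmul_eq_mul, Nat.cast_ofNat]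
    calc moment α β 1 (N + 2) j = ∑ i ∈ Ico j (N + 2 - 1), stepWt α β (N + 2) i := moment_one _ _
      _ ≤ _ := sum_le_sum_of_subset_of_nonneg hsub fun i _ _ => stepWt_nonneg hα hβ _ i
      _ = _ := sum_union hdisj
      _ ≤ _ := by rw [hsum]; gcongr
  rw [abs_le]
  constructor <;> nlinarith

theorem pow_succ_sub_bounds {y z : ℝ} (hz : 0 ≤ z) (hzy : z ≤ y) (hy : y ≤ 1) (r : ℕ) :
    0 ≤ (r + 1) * ((y - z) * y ^ r) - (y ^ (r + 1) - z ^ (r + 1)) ∧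
      (r + 1) * ((y - z) * y ^ r) - (y ^ (r + 1) - z ^ (r + 1)) ≤ (r + 1) * r * (y - z) ^ 2 := by
  have hd : 0 ≤ y - z := sub_nonneg.2 hzy
  have hy0 : 0 ≤ y := hz.trans hzy
  induction r with
  | zero => simp
  | succ r ih =>
    obtain ⟨h1, h2⟩ := ih
    have h3 : 0 ≤ y ^ (r + 1) - z ^ (r + 1) := sub_nonneg.2 (pow_le_pow_left₀ hz hzy _)
    have h4 : y ^ (r + 1) - z ^ (r + 1) ≤ (r + 1) * (y - z) := by
      have : (r + 1) * ((y - z) * y ^ r) ≤ (r + 1) * ((y - z) * 1) := by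
        gcongr
        exact pow_le_one₀ hy0 hy
      linarith
    have h5 : ((r + 1 : ℕ) + 1 : ℝ) * ((y - z) * y ^ (r + 1)) - (y ^ (r + 1 + 1) - z ^ (r + 1 + 1)) =
        y * ((r + 1) * ((y - z) * y ^ r) - (y ^ (r + 1) - z ^ (r + 1))) +
          (y - z) * (y ^ (r + 1) - z ^ (r + 1)) := by
      push_cast
      ring
    have h6 := mul_nonneg hy0 h1
    have h7 := mul_le_mul_of_nonneg_right hy h1
    have h8 := mul_nonneg hd h3
    have h9 := mul_le_mul_of_nonneg_left h4 hd
    have h10 : 0 ≤ (r + 1 : ℝ) * (y - z) ^ 2 := by positivity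
    rw [h5]
    push_cast
    constructor <;> nlinarith

theorem abs_mul_pow_sub_le {y z : ℝ} (hz : 0 ≤ z) (hzy : z ≤ y) (hy : y ≤ 1) (r : ℕ) :
    |(y - z) * y ^ r - (y ^ (r + 1) - z ^ (r + 1)) / (r + 1)| ≤ r * (y - z) ^ 2 := by
  obtain ⟨h1, h2⟩ := pow_succ_sub_bounds hz hzy hy r
  have hr : (0 : ℝ) < r + 1 := by positivity
  have h : (y - z) * y ^ r - (y ^ (r + 1) - z ^ (r + 1)) / (r + 1) =
      ((r + 1) * ((y - z) * y ^ r) - (y ^ (r + 1) - z ^ (r + 1))) / (r + 1) := by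
    field_simp
  rw [h, abs_of_nonneg (div_nonneg h1 hr.le), div_le_iff₀ hr]
  linarith

theorem abs_sum_sub_moment_one_pow_le (hα : 0 < α) (hβ : 0 < β) (r N i : ℕ) :
    |∑ j ∈ Ico i (N - 1), stepWt α β N j * moment α β 1 N j ^ r -
      moment α β 1 N i ^ (r + 1) / (r + 1)| ≤ r * maxWt α β N := by
  have hW : 0 ≤ maxWt α β N := stepWt_nonneg hα hβ _ _
  rcases le_or_gt i (N - 1) with hi | hi
  · set f : ℕ → ℝ := fun j => moment α β 1 N j with hf
    have hstep : ∀ j ∈ Ico i (N - 1), stepWt α β N j = f j - f (j + 1) := fun j hj => by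
      simp only [hf]
      rw [moment_one, moment_one, sum_eq_sum_Ico_succ_bot (mem_Ico.1 hj).2]
      ring
    have htel : ∑ j ∈ Ico i (N - 1), (f j ^ (r + 1) - f (j + 1) ^ (r + 1)) / (r + 1) =
        f i ^ (r + 1) / (r + 1) := by
      rw [← sum_div]
      have h0 : f (N - 1) = 0 := by simp [hf, moment_one]
      have := sum_Ico_sub (fun j => f j ^ (r + 1)) hi
      rw [← neg_inj, ← sum_neg_distrib] at this
      simp only [neg_sub] at this
      rw [this, h0]
      simp
    change |∑ j ∈ Ico i (N - 1), stepWt α β N j * f j ^ r - f i ^ (r + 1) / (r + 1)| ≤ _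
    rw [← htel, ← sum_sub_distrib]
    calc _ ≤ ∑ j ∈ Ico i (N - 1), |stepWt α β N j * f j ^ r -
            (f j ^ (r + 1) - f (j + 1) ^ (r + 1)) / (r + 1)| := abs_sum_le_sum_abs _ _
      _ ≤ ∑ j ∈ Ico i (N - 1), stepWt α β N j * (r * maxWt α β N) := by
          refine sum_le_sum fun j hj => ?_
          have hw := stepWt_nonneg hα hβ N j
          have hle := stepWt_le_maxWt hα hβ (N := N) (j := j) (by rw [mem_Ico] at hj; omega)
          rw [hstep j hj] at hw hle ⊢
          refine (abs_mul_pow_sub_le (moment_nonneg hα hβ 1 N _) (sub_nonneg.1 hw)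
            (moment_one_le_one hα hβ N j) r).trans ?_
          have := mul_le_mul_of_nonneg_left (mul_le_mul_of_nonneg_left hle hw) (Nat.cast_nonneg r)
          linarith
      _ = moment α β 1 N i * (r * maxWt α β N) := by rw [← sum_mul, ← moment_one]
      _ ≤ 1 * (r * maxWt α β N) := by gcongr; exact moment_one_le_one hα hβ N i
      _ = _ := one_mul _
  · have h0 : moment α β 1 N i = 0 := by rw [moment_one, Ico_eq_empty_of_le hi.le, sum_empty]
    rw [Ico_eq_empty_of_le hi.le, h0]
    simpa using mul_nonneg (Nat.cast_nonneg r) hW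

theorem moment_uniform (hα : 0 < α) (hβ : 0 < β) (r : ℕ) :
    ∀ ε > 0, ∀ᶠ N in atTop, ∀ i,
      |moment α β r N i - moment α β 1 N i ^ r / r.factorial| ≤ ε := by
  induction r with
  | zero =>
    intro ε hε
    exact .of_forall fun N i => by simpa [moment] using hε.le
  | succ r ih =>
    intro ε hε
    have hr : (0 : ℝ) ≤ r := Nat.cast_nonneg r
    have hfact : (1 : ℝ) ≤ r.factorial := by exact_mod_cast r.factorial_pos
    have hfact0 : (0 : ℝ) < r.factorial := by positivity
    have hW : Tendsto (fun M => maxWt α β (M + 2)) atTop (𝓝 0) :=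
      (tendsto_add_atTop_iff_nat 2).2 (tendsto_maxWt hα hβ)
    have hsmall : Tendsto (fun M => r * ((1 - shiftRatio α β M) + 2 * maxWt α β (M + 2)) +
        r * maxWt α β (M + 2)) atTop (𝓝 0) := by
      simpa using ((((tendsto_const_nhds (x := (1 : ℝ))).sub (tendsto_shiftRatio hα hβ)).add
        (hW.const_mul 2)).const_mul (r : ℝ)).add (hW.const_mul (r : ℝ))
    have key : ∀ᶠ M in atTop, ∀ i, |moment α β (r + 1) (M + 2) i -
        moment α β 1 (M + 2) i ^ (r + 1) / (r + 1).factorial| ≤ ε := by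
      filter_upwards [ih (ε / 2) (half_pos hε), eventually_ge_atTop 1,
        hsmall.eventually_le_const (half_pos hε)] with M hM hM1 hMε i
      set y : ℕ → ℝ := fun j => moment α β 1 (M + 2) j with hy
      set δ := (1 - shiftRatio α β M) + 2 * maxWt α β (M + 2) with hδ
      have hδ0 : 0 ≤ δ := (abs_nonneg _).trans (abs_moment_one_sub_le hα hβ hM1 0)
      have hy0 : ∀ N j, |moment α β 1 N j| ≤ 1 := fun N j => by
        rw [abs_of_nonneg (moment_nonneg hα hβ 1 N j)]
        exact moment_one_le_one hα hβ N j
      have hpow : ∀ j, |moment α β 1 M j ^ r / r.factorial - y j ^ r / r.factorial| ≤ r * δ :=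
        fun j => by
          rw [← sub_div, abs_div, abs_of_pos hfact0]
          refine (div_le_self (abs_nonneg _) hfact).trans ((abs_pow_sub_pow_le _ _ r).trans ?_)
          rw [abs_sub_comm, mul_comm (r : ℝ) δ, ← mul_one (δ * r)]
          refine mul_le_mul (mul_le_mul_of_nonneg_right (abs_moment_one_sub_le hα hβ hM1 j) hr)
            (pow_le_one₀ (le_max_of_le_left (abs_nonneg _)) (max_le (hy0 _ _) (hy0 _ _)))
            (pow_nonneg (le_max_of_le_left (abs_nonneg _)) _) (mul_nonneg hδ0 hr)
      have hterm : ∀ j, |moment α β r M j - y j ^ r / r.factorial| ≤ ε / 2 + r * δ := fun j =>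
        (abs_sub_le _ _ _).trans (add_le_add (hM j) (hpow j))
      have hsplit : moment α β (r + 1) (M + 2) i - y i ^ (r + 1) / (r + 1).factorial =
          ∑ j ∈ Ico i (M + 2 - 1), stepWt α β (M + 2) j *
            (moment α β r M j - y j ^ r / r.factorial) +
          (∑ j ∈ Ico i (M + 2 - 1), stepWt α β (M + 2) j * y j ^ r - y i ^ (r + 1) / (r + 1)) /
            r.factorial := by
        rw [moment, Nat.add_sub_cancel, sub_div, sum_div, add_sub, ← sum_add_distrib,
          Nat.factorial_succ, div_div]
        congr 1
        · exact sum_congr rfl fun j _ => by ring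
        · push_cast
          rfl
      have hfirst : |∑ j ∈ Ico i (M + 2 - 1), stepWt α β (M + 2) j *
          (moment α β r M j - y j ^ r / r.factorial)| ≤ ε / 2 + r * δ := by
        calc _ ≤ ∑ j ∈ Ico i (M + 2 - 1), |stepWt α β (M + 2) j *
                (moment α β r M j - y j ^ r / r.factorial)| := abs_sum_le_sum_abs _ _
          _ ≤ ∑ j ∈ Ico i (M + 2 - 1), stepWt α β (M + 2) j * (ε / 2 + r * δ) := by
              refine sum_le_sum fun j _ => ?_
              rw [abs_mul, abs_of_nonneg (stepWt_nonneg hα hβ _ _)]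
              exact mul_le_mul_of_nonneg_left (hterm j) (stepWt_nonneg hα hβ _ _)
          _ = y i * (ε / 2 + r * δ) := by rw [← sum_mul, ← moment_one]
          _ ≤ 1 * (ε / 2 + r * δ) :=
              mul_le_mul_of_nonneg_right (moment_one_le_one hα hβ _ _) (by positivity)
          _ = _ := one_mul _
      have hsecond : |(∑ j ∈ Ico i (M + 2 - 1), stepWt α β (M + 2) j * y j ^ r -
          y i ^ (r + 1) / (r + 1)) / r.factorial| ≤ r * maxWt α β (M + 2) := by
        rw [abs_div, abs_of_pos hfact0]
        exact (div_le_self (abs_nonneg _) hfact).trans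
          (abs_sum_sub_moment_one_pow_le hα hβ r (M + 2) i)
      change |moment α β (r + 1) (M + 2) i - y i ^ (r + 1) / (r + 1).factorial| ≤ ε
      rw [hsplit]
      refine (abs_add_le _ _).trans ((add_le_add hfirst hsecond).trans ?_)
      linarith
    filter_upwards [(tendsto_sub_atTop_nat 2).eventually key, eventually_ge_atTop 2] with N h hN
    rwa [Nat.sub_add_cancel hN] at h

theorem tendsto_moment (hα : 0 < α) (hβ : 0 < β) (r : ℕ) :
    Tendsto (fun N => moment α β r N 0) atTop (𝓝 ((1 / 2) ^ r / r.factorial)) := by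
  have h : Tendsto (fun N => moment α β r N 0 - moment α β 1 N 0 ^ r / r.factorial) atTop
      (𝓝 0) := by
    rw [Metric.tendsto_nhds]
    intro ε hε
    filter_upwards [moment_uniform hα hβ r (ε / 2) (half_pos hε)] with N hN
    rw [Real.dist_eq, sub_zero]
    exact (hN 0).trans_lt (half_lt_self hε)
  simpa using h.add (((tendsto_moment_one hα hβ).pow r).div_const (r.factorial : ℝ))

theorem sum_tableaux_monomial (α β : ℝ) (n : ℕ) :
    ∑ T ∈ tableaux n, C (stairWt α β T) * X ^ diagAlphas n T =
      taylor (-1) (recPoly α β n 0) := by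
  refine Polynomial.funext fun t => ?_
  rw [taylor_eval, ← sub_eq_add_neg, eval_recPoly, gf, eval_finsetSum]
  simp

theorem sum_tableaux_diagAlphas_eq (α β : ℝ) (n k : ℕ) :
    ∑ T ∈ tableaux n with diagAlphas n T = k, stairWt α β T =
      (taylor (-1) (recPoly α β n 0)).coeff k := by
  rw [← sum_tableaux_monomial, finsetSum_coeff, sum_filter]
  refine sum_congr rfl fun T _ => ?_
  rw [coeff_C_mul, coeff_X_pow]
  simp [eq_comm]

theorem stairZ_eq_prod (hα : 0 < α) (hβ : 0 < β) (n : ℕ) :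
    stairZ n α β = ∏ j ∈ range n, aCoef α β j := by
  have h : {S | IsStaircase n S} = (tableaux n : Set (ℕ → ℕ → StairSymb)) := by
    ext S
    exact mem_tableaux.symm
  have hgf := eval_recPoly α β 1 n 0
  rw [sub_self, ← coeff_zero_eq_eval_zero, coeff_recPoly hα hβ, gf] at hgf
  rw [stairZ, h, finsum_mem_coe_finset]
  simpa [moment] using hgf.symm

theorem stairP_diagAlphas (hα : 0 < α) (hβ : 0 < β) (n k : ℕ) :
    stairP n α β (fun S => diagAlphas n S = k) =
      ∑' r : ℕ, ((r + k).choose k * moment α β (r + k) n 0) * (-1) ^ r := by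
  have h : {S | IsStaircase n S ∧ diagAlphas n S = k} =
      (({T ∈ tableaux n | diagAlphas n T = k} : Finset _) : Set (ℕ → ℕ → StairSymb)) := by
    ext S
    simp [mem_tableaux]
  have hZ : (∏ j ∈ range n, aCoef α β j) ≠ 0 :=
    (prod_pos fun j _ => aCoef_pos hα hβ j).ne'
  have hsum : ∀ p : ℝ[X], p.eval (-1) = ∑' r, p.coeff r * (-1) ^ r := fun p => by
    rw [eval_eq_sum_range, tsum_eq_sum fun r hr => ?_]
    rw [coeff_eq_zero_of_natDegree_lt (by simpa using hr), zero_mul]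
  rw [stairP, h, finsum_mem_coe_finset, sum_tableaux_diagAlphas_eq, stairZ_eq_prod hα hβ,
    taylor_coeff, hsum, div_eq_iff hZ, ← tsum_mul_right]
  refine tsum_congr fun r => ?_
  rw [hasseDeriv_coeff, coeff_recPoly hα hβ]
  simp only [zero_add, add_zero]
  ring

theorem tsum_choose_mul_poisson (k : ℕ) :
    ∑' r : ℕ, ((r + k).choose k * ((1 / 2 : ℝ) ^ (r + k) / (r + k).factorial)) * (-1) ^ r =
      Real.exp (-(1 / 2)) * (1 / 2) ^ k / k.factorial := by
  rw [Real.exp_eq_exp_ℝ, NormedSpace.exp_eq_tsum_div, mul_div_assoc, ← tsum_mul_right]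
  refine tsum_congr fun r => ?_
  rw [← Nat.add_choose_mul_factorial_mul_factorial r k]
  have h : ((r + k).choose k : ℝ) ≠ 0 := by
    exact_mod_cast (Nat.choose_pos (by omega)).ne'
  rw [neg_pow (1 / 2 : ℝ) r]
  push_cast
  field_simp
  ring

theorem tendsto_stairP_diagAlphas (hα : 0 < α) (hβ : 0 < β) (k : ℕ) :
    Tendsto (fun n => stairP n α β (fun S => diagAlphas n S = k)) atTop
      (𝓝 (Real.exp (-(1 / 2)) * (1 / 2) ^ k / k.factorial)) := by
  simp only [stairP_diagAlphas hα hβ, ← tsum_choose_mul_poisson]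
  have hq : ‖ratio α β‖ < 1 := by
    rw [Real.norm_of_nonneg (ratio_pos α β).le]
    exact ratio_lt_one hα hβ
  refine tendsto_tsum_of_dominated_convergence
    ((summable_choose_mul_geometric_of_norm_lt_one k hq).mul_right (ratio α β ^ k))
    (fun r => ((tendsto_moment hα hβ (r + k)).const_mul _).mul_const _)
    (.of_forall fun n r => ?_)
  rw [norm_mul, norm_pow, norm_neg, norm_one, one_pow, mul_one, norm_mul, Real.norm_natCast,
    Real.norm_of_nonneg (moment_nonneg hα hβ _ _ _), mul_assoc, ← pow_add]
  exact mul_le_mul_of_nonneg_left (moment_le_ratio_pow hα hβ _ _ _) (Nat.cast_nonneg _)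

end Staircase

/-- The number `A_n` of α's on the second main diagonal converges in distribution to
`Pois(1/2)`. -/
theorem alphas_second_diagonal_poisson
    (α β : ℝ) (hα : 0 < α) (hβ : 0 < β) (k : ℕ) :
    Filter.Tendsto (fun n : ℕ =>
        stairP n α β (fun S =>
          (((Finset.Icc 1 (n - 1)).filter
            (fun j => S (n - j) j = StairSymb.alpha)).card) = k))
      Filter.atTop
      (nhds (Real.exp (-(1 / 2 : ℝ)) * (1 / 2 : ℝ) ^ k / (Nat.factorial k : ℝ))) := by
  exact Staircase.tendsto_stairP_diagAlphas hα hβ k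
end
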